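/- Let F : U → ℝ be analytic on an open subset U of ℝⁿ containing 0 with ∇F(0) = 0. Then there exist α ∈ (0, 1/2], C > 0 and a neighbourhood V ⊆ U of 0 such that |F(x) - F(0)|^{1-α} ≤ C‖∇F(x)‖ for all x ∈ V. -/

import Mathlib

namespace Loj
open Filter Topology Set

variable {X : Type*} [NormedAddCommGroup X] [NormedSpace ℝ X]

/-- Division of an analytic germ by a linear functional. -/
theorem hadamard_division [CompleteSpace X] (l : X →L[ℝ] ℝ) (e : X) (π : X →L[ℝ] X)
    (hπ : ∀ x, π x = x - l x • e) {f : X → ℝ} (hf : AnalyticAt ℝ f 0) :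
    ∃ g : X → ℝ, AnalyticAt ℝ g 0 ∧ ∀ᶠ x in 𝓝 0, f x = f (π x) + l x * g x := by
  obtain ⟨p, hp⟩ := hf
  have hpr : 0 < p.radius := by
    obtain ⟨r, hr⟩ := hp
    exact hr.r_pos.trans_le hr.r_le
  obtain ⟨C, r, hC, hr, hb⟩ := p.le_mul_pow_of_radius_pos hpr
  set B : ℝ := max 1 ‖π‖ with hB
  have hB1 : 1 ≤ B := le_max_left _ _
  let q : FormalMultilinearSeries ℝ X ℝ := fun k =>
    ∑ i : Fin (k+1), ((p (k+1)).curryMid i e).compContinuousLinearMap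
      (fun j : Fin k => if (i.succAbove j) < i then π else ContinuousLinearMap.id ℝ X)
  have hq : ∀ k, ‖q k‖ ≤ (C * r * ‖e‖) * (2 * r * B)^k := by
    intro k
    have h1 : ∀ i : Fin (k+1), ‖((p (k+1)).curryMid i e).compContinuousLinearMap
      (fun j : Fin k => if (i.succAbove j) < i then π else ContinuousLinearMap.id ℝ X)‖
        ≤ C * r^(k+1) * ‖e‖ * B^k := by
      intro i
      refine (ContinuousMultilinearMap.norm_compContinuousLinearMap_le _ _).trans ?_
      have h2 : ‖(p (k+1)).curryMid i e‖ ≤ C * r^(k+1) * ‖e‖ := by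
        refine ((p (k+1)).curryMid i).le_opNorm e |>.trans ?_
        gcongr
        rw [ContinuousMultilinearMap.norm_curryMid]
        exact hb _
      gcongr
      calc _ ≤ ∏ j : Fin k, B := by
            apply Finset.prod_le_prod
            · intros; positivity
            · intro j _
              split_ifs
              · exact le_max_right _ _
              · exact ContinuousLinearMap.norm_id_le.trans hB1
        _ = B^k := by simp
    calc ‖q k‖ ≤ ∑ i : Fin (k+1), C * r^(k+1) * ‖e‖ * B^k := norm_sum_le_of_le _ (fun i _ => h1 i)
      _ = (k+1 : ℝ) * (C * r^(k+1) * ‖e‖ * B^k) := by simp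
      _ ≤ 2^k * (C * r^(k+1) * ‖e‖ * B^k) := by
          gcongr
          have := Nat.lt_two_pow_self (n := k)
          exact_mod_cast this
      _ = _ := by rw [mul_pow, mul_pow]; ring
  have hR : 0 < 2 * r * B := by positivity
  have hqr : 0 < q.radius := by
    obtain ⟨ρ, hρ⟩ : ∃ ρ : NNReal, (ρ : ℝ) = (2*r*B)⁻¹ :=
      ⟨Real.toNNReal (2*r*B)⁻¹, Real.coe_toNNReal _ (by positivity)⟩
    have : (ρ : ENNReal) ≤ q.radius := by
      apply q.le_radius_of_bound (C * r * ‖e‖)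
      intro n
      rw [hρ, inv_pow]
      have := hq n
      rw [← div_eq_mul_inv, div_le_iff₀ (by positivity)]
      exact this
    refine lt_of_lt_of_le ?_ this
    simp only [ENNReal.coe_pos]
    rw [← NNReal.coe_pos, hρ]
    positivity
  have hqq := q.hasFPowerSeriesOnBall hqr
  refine ⟨q.sum, hqq.analyticAt, ?_⟩
  have key : ∀ k x, p (k+1) (fun _ => x) - p (k+1) (fun _ => π x) = l x * q k (fun _ => x) := by
    intro k x
    let S : ℕ → ℝ := fun i => p (k+1) (fun j : Fin (k+1) => if (j:ℕ) < i then π x else x)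
    have e1 : p (k+1) (fun _ => x) = S 0 := by simp [S]
    have e2 : p (k+1) (fun _ => π x) = S (k+1) := by
      simp only [S]
      congr 1
      ext j
      simp [j.2]
    rw [e1, e2, ← Finset.sum_range_sub', Finset.sum_range]
    simp only [q, sum_apply, Finset.mul_sum]
    apply Finset.sum_congr rfl
    intro i _
    have e3 : (fun j : Fin (k+1) => if (j:ℕ) < i then π x else x)
       = i.insertNth x (fun j : Fin k => if i.succAbove j < i then π x else x) := by
      rw [Fin.eq_insertNth_iff]
      constructor
      · simp
      · ext j; simp [Fin.removeNth]
    have e4 : (fun j : Fin (k+1) => if (j:ℕ) < (i:ℕ)+1 then π x else x)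
       = i.insertNth (π x) (fun j : Fin k => if i.succAbove j < i then π x else x) := by
      rw [Fin.eq_insertNth_iff]
      constructor
      · simp
      · ext j
        simp only [Fin.removeNth]
        have : i.succAbove j ≠ i := Fin.succAbove_ne i j
        have h' : ((i.succAbove j : Fin (k+1)) : ℕ) ≠ i := fun h => this (Fin.ext h)
        have : ((i.succAbove j : Fin (k+1)) : ℕ) < (i:ℕ) + 1 ↔ i.succAbove j < i := by
          rw [Fin.lt_def]; omega
        simp only [this]
    simp only [S]
    rw [e3, e4]
    have := fun y => (ContinuousMultilinearMap.curryMid_apply i (p (k+1)) y (fun j : Fin k => if i.succAbove j < i then π x else x))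
    rw [← this, ← this, ← sub_apply, ← map_sub, hπ x]
    have e5 : x - (x - l x • e) = l x • e := by abel
    rw [e5, map_smul]
    simp only [smul_apply, smul_eq_mul,
      ContinuousMultilinearMap.compContinuousLinearMap_apply]
    congr 2
    ext j
    split_ifs <;> simp [hπ]
  obtain ⟨rp, hrp⟩ := hp
  have hev1 : ∀ᶠ x in 𝓝 (0:X), x ∈ Metric.eball (0:X) rp := Metric.eball_mem_nhds _ hrp.r_pos
  have hev2 : ∀ᶠ x in 𝓝 (0:X), π x ∈ Metric.eball (0:X) rp := by
    have : Tendsto π (𝓝 0) (𝓝 0) := by simpa using π.continuous.tendsto 0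
    exact this.eventually hev1
  have hev3 : ∀ᶠ x in 𝓝 (0:X), x ∈ Metric.eball (0:X) q.radius := Metric.eball_mem_nhds _ hqr
  filter_upwards [hev1, hev2, hev3] with x h1 h2 h3
  have s1 := hrp.hasSum h1
  have s2 := hrp.hasSum h2
  have s3 := (hqq.hasSum h3).mul_left (l x)
  simp only [zero_add] at s1 s2 s3
  have s4 := s1.sub s2
  rw [← hasSum_nat_add_iff' 1] at s4
  simp only [key] at s4
  have e0 : p 0 (fun _ => x) = p 0 (fun _ => π x) := by congr 1; ext i; exact i.elim0
  simp only [Finset.range_one, Finset.sum_singleton, e0, sub_self, sub_zero] at s4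
  linarith [s4.unique s3]

/-- germs of analytic functions form a domain -/
theorem mul_eq_zero_germ {f g : X → ℝ} (hf : AnalyticAt ℝ f 0)
    (hg : AnalyticAt ℝ g 0) (h : ∀ᶠ x in 𝓝 0, f x * g x = 0) :
    (∀ᶠ x in 𝓝 0, f x = 0) ∨ (∀ᶠ x in 𝓝 0, g x = 0) := by
  obtain ⟨r, hr, hball⟩ := Metric.eventually_nhds_iff_ball.1
    ((hf.eventually_analyticAt.and hg.eventually_analyticAt).and h)
  by_cases hz : ∀ x ∈ Metric.ball (0:X) r, f x = 0
  · left
    exact Metric.eventually_nhds_iff_ball.2 ⟨r, hr, hz⟩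
  right
  push Not at hz
  obtain ⟨x, hx, hfx⟩ := hz
  have hga : AnalyticOnNhd ℝ g (Metric.ball (0:X) r) := fun y hy => (hball y hy).1.2
  have hev : g =ᶠ[𝓝 x] 0 := by
    filter_upwards [(hball x hx).1.1.continuousAt.eventually_ne hfx, Metric.isOpen_ball.mem_nhds hx]
      with y hy hy2
    exact (mul_eq_zero.1 (hball y hy2).2).resolve_left hy
  have := hga.eqOn_zero_of_preconnected_of_eventuallyEq_zero
    (convex_ball (0:X) r).isPreconnected hx hev
  exact Metric.eventually_nhds_iff_ball.2 ⟨r, hr, this⟩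

end Loj

namespace Loj
open Filter Topology Set

variable {X : Type*} [NormedAddCommGroup X] [NormedSpace ℝ X]

/-- A family of germs of maps at `0` whose images cover neighbourhoods of `0`,
in a form which includes a finiteness (compactness) statement. -/
def Cover {ι : Type} (φ : ι → X → X) : Prop :=
  ∀ p : Set X → Prop, p ∅ → (∀ s t, s ⊆ t → p t → p s) → (∀ s t, p s → p t → p (s ∪ t)) →
    (∀ i, ∃ W ∈ 𝓝 (0:X), p (φ i '' W)) → ∃ V ∈ 𝓝 (0:X), p V

/-- `f` can be brought into the form `B` by finitely many iterated analytic covers. -/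
inductive Unif (B : (X → ℝ) → Prop) : (X → ℝ) → Prop
  | base (f : X → ℝ) (h : B f) : Unif B f
  | step (f : X → ℝ) (ι : Type) (φ : ι → X → X) (hφ : ∀ i, AnalyticAt ℝ (φ i) 0)
      (h0 : ∀ i, φ i 0 = 0) (hc : Cover φ) (h : ∀ i, Unif B (fun x => f (φ i x))) : Unif B f

/-- The gradient inequality on a set. -/
def Ineq (f : X → ℝ) (S : Set X) : Prop :=
  ∃ α ∈ Set.Ioc (0:ℝ) (1/2), ∃ C > (0:ℝ), ∀ x ∈ S, |f x| ^ (1 - α) ≤ C * ‖fderiv ℝ f x‖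

theorem Unif.ineq [CompleteSpace X] {B : (X → ℝ) → Prop}
    (hB : ∀ f, B f → f 0 = 0 → ∃ V ∈ 𝓝 (0:X), Ineq f V) {f : X → ℝ} (h : Unif B f) :
    AnalyticAt ℝ f 0 → f 0 = 0 → ∃ V ∈ 𝓝 (0:X), Ineq f V := by
  induction h with
  | base f h => exact fun _ h0 => hB f h h0
  | step f ι φ hφ h0 hc h ih =>
    intro hf hf0
    have hone : ∀ᶠ x in 𝓝 (0:X), |f x| ≤ 1 := by
      have : Tendsto (fun x => |f x|) (𝓝 0) (𝓝 0) := by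
        simpa [hf0] using hf.continuousAt.abs.tendsto
      exact (this.eventually_lt_const one_pos).mono fun x hx => hx.le
    obtain ⟨V, hV, hVI⟩ := hc (fun S => Ineq f (S ∩ {x | |f x| ≤ 1}))
      ⟨1/2, by norm_num, 1, one_pos, by simp⟩
      (by
        rintro s t hst ⟨α, hα, C, hC, h⟩
        exact ⟨α, hα, C, hC, fun x hx => h x ⟨hst hx.1, hx.2⟩⟩)
      (by
        rintro s t ⟨α, hα, C, hC, h⟩ ⟨α', hα', C', hC', h'⟩
        refine ⟨min α α', ⟨lt_min hα.1 hα'.1, (min_le_left _ _).trans hα.2⟩, max C C',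
          lt_max_of_lt_left hC, ?_⟩
        have aux : ∀ x, |f x| ≤ 1 → ∀ β, β ∈ Set.Ioc (0:ℝ) (1/2) → min α α' ≤ β → ∀ D, D ≤ max C C' →
            |f x| ^ (1 - β) ≤ D * ‖fderiv ℝ f x‖ →
            |f x| ^ (1 - min α α') ≤ max C C' * ‖fderiv ℝ f x‖ := by
          intro x hx β hβ hmin D hD hh
          refine (Real.rpow_le_rpow_of_exponent_ge_of_imp (abs_nonneg _) hx
            (by linarith : 1 - β ≤ 1 - min α α') ?_).trans (hh.trans ?_)
          · intro _ h2; linarith [hβ.2]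
          · gcongr
        rintro x ⟨hx | hx, hx1⟩
        · exact aux x hx1 α hα (min_le_left _ _) C (le_max_left _ _) (h x ⟨hx, hx1⟩)
        · exact aux x hx1 α' hα' (min_le_right _ _) C' (le_max_right _ _) (h' x ⟨hx, hx1⟩))
      (by
        intro i
        have hcomp : AnalyticAt ℝ (fun x => f (φ i x)) 0 :=
          AnalyticAt.fun_comp (by rw [h0 i]; exact hf) (hφ i)
        obtain ⟨V, hV, α, hα, C, hC, hVI⟩ := ih i hcomp (by simp [h0 i, hf0])
        have hK : ∀ᶠ y in 𝓝 (0:X), ‖fderiv ℝ (φ i) y‖ < ‖fderiv ℝ (φ i) 0‖ + 1 := by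
          have := (hφ i).fderiv.continuousAt.norm
          exact this.eventually_lt_const (by linarith)
        have hd1 : ∀ᶠ y in 𝓝 (0:X), DifferentiableAt ℝ (φ i) y :=
          (hφ i).eventually_analyticAt.mono fun y hy => hy.differentiableAt
        have hd2 : ∀ᶠ y in 𝓝 (0:X), DifferentiableAt ℝ f (φ i y) := by
          have : Tendsto (φ i) (𝓝 0) (𝓝 0) := by simpa [h0 i] using (hφ i).continuousAt.tendsto
          exact this.eventually (hf.eventually_analyticAt.mono fun y hy => hy.differentiableAt)
        refine ⟨V ∩ {y | ‖fderiv ℝ (φ i) y‖ < ‖fderiv ℝ (φ i) 0‖ + 1 ∧ DifferentiableAt ℝ (φ i) y ∧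
          DifferentiableAt ℝ f (φ i y)}, inter_mem hV (hK.and (hd1.and hd2)), α, hα,
          C * (‖fderiv ℝ (φ i) 0‖ + 1), by positivity, ?_⟩
        rintro x ⟨⟨y, ⟨hyV, hy1, hy2, hy3⟩, rfl⟩, -⟩
        refine (hVI y hyV).trans ?_
        have : fderiv ℝ (fun x => f (φ i x)) y = (fderiv ℝ f (φ i y)).comp (fderiv ℝ (φ i) y) :=
          fderiv_comp y hy3 hy2
        rw [this, mul_assoc]
        gcongr
        refine (ContinuousLinearMap.opNorm_comp_le _ _).trans ?_
        rw [mul_comm]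
        gcongr)
    exact ⟨V ∩ {x | |f x| ≤ 1}, inter_mem hV hone, hVI⟩

theorem Unif.congr {B : (X → ℝ) → Prop}
    (hB : ∀ f g : X → ℝ, B f → (∀ᶠ x in 𝓝 0, g x = f x) → B g) {f : X → ℝ} (h : Unif B f) :
    ∀ {g : X → ℝ}, (∀ᶠ x in 𝓝 0, g x = f x) → Unif B g := by
  induction h with
  | base f h => exact fun hg => .base _ (hB _ _ h hg)
  | step f ι φ hφ h0 hc h ih =>
    intro g hg
    refine .step _ ι φ hφ h0 hc fun i => ih i ?_
    have : Tendsto (φ i) (𝓝 0) (𝓝 0) := by simpa [h0 i] using (hφ i).continuousAt.tendsto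
    exact this.eventually hg

theorem Unif.unit_mul {B : (X → ℝ) → Prop}
    (hB : ∀ f u : X → ℝ, B f → AnalyticAt ℝ u 0 → u 0 ≠ 0 → B (fun x => u x * f x))
    {f : X → ℝ} (h : Unif B f) :
    ∀ {u : X → ℝ}, AnalyticAt ℝ u 0 → u 0 ≠ 0 → Unif B (fun x => u x * f x) := by
  induction h with
  | base f h => exact fun hu hu0 => .base _ (hB _ _ h hu hu0)
  | step f ι φ hφ h0 hc h ih =>
    intro u hu hu0
    refine .step _ ι φ hφ h0 hc fun i => ih i (u := fun x => u (φ i x)) ?_ ?_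
    · exact AnalyticAt.fun_comp (by rw [h0 i]; exact hu) (hφ i)
    · simpa [h0 i] using hu0

/-- monomials -/
def mono {n : ℕ} (γ : Fin n → ℕ) (x : Fin n → ℝ) : ℝ := ∏ i, x i ^ γ i

/-- monomial times unit on `ℝⁿ` -/
def BE (n : ℕ) (f : (Fin n → ℝ) → ℝ) : Prop :=
  ∃ (γ : Fin n → ℕ) (u : (Fin n → ℝ) → ℝ), AnalyticAt ℝ u 0 ∧ u 0 ≠ 0 ∧
    ∀ᶠ x in 𝓝 0, f x = mono γ x * u x

/-- monomial times unit on `ℝ × ℝⁿ` -/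
def BX (n : ℕ) (f : ℝ × (Fin n → ℝ) → ℝ) : Prop :=
  ∃ (m : ℕ) (γ : Fin n → ℕ) (u : ℝ × (Fin n → ℝ) → ℝ), AnalyticAt ℝ u 0 ∧ u 0 ≠ 0 ∧
    ∀ᶠ p in 𝓝 0, f p = p.1 ^ m * mono γ p.2 * u p

theorem BE.ineq {n : ℕ} {f : (Fin n → ℝ) → ℝ} (h : BE n f) (h0 : f 0 = 0) :
    ∃ V ∈ 𝓝 (0 : Fin n → ℝ), Ineq f V := by
  obtain ⟨γ, u, hu, hu0, hfu⟩ := h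
  set S : Finset (Fin n) := Finset.univ.filter (fun i => 0 < γ i) with hS
  have hSne : S.Nonempty := by
    by_contra hne
    rw [Finset.not_nonempty_iff_eq_empty, Finset.filter_eq_empty_iff] at hne
    have hγ : ∀ i, γ i = 0 := fun i => by have := hne (Finset.mem_univ i); omega
    have := hfu.self_of_nhds
    simp [mono, hγ, h0] at this
    exact hu0 this.symm
  set m := ∑ i, γ i with hm
  set a := |u 0| with ha
  have ha0 : 0 < a := abs_pos.2 hu0
  set K := ‖fderiv ℝ u 0‖ + 1 with hK
  have hK0 : 0 < K := by positivity
  have ev1 : ∀ᶠ x in 𝓝 (0 : Fin n → ℝ), ‖fderiv ℝ u x‖ < K :=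
    hu.fderiv.continuousAt.norm.eventually_lt_const (by simp [hK])
  have ev2 : ∀ᶠ x in 𝓝 (0 : Fin n → ℝ), |u x| < 2 * a :=
    hu.continuousAt.abs.eventually_lt_const (by linarith)
  have ev3 : ∀ᶠ x in 𝓝 (0 : Fin n → ℝ), a / 2 < |u x| :=
    hu.continuousAt.abs.eventually_const_lt (by linarith)
  have ev4 : ∀ᶠ x in 𝓝 (0 : Fin n → ℝ), ‖x‖ < min 1 (a / (4 * K)) :=
    continuousAt_id.norm.eventually_lt_const (by simp; positivity)
  have ev5 : ∀ᶠ x in 𝓝 (0 : Fin n → ℝ), DifferentiableAt ℝ u x :=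
    hu.eventually_analyticAt.mono fun y hy => hy.differentiableAt
  have hmm : (0:ℝ) < (m:ℝ) + 1 := by positivity
  have hm1 : 1 ≤ m := by
    obtain ⟨i, hi⟩ := hSne
    have h1 : 0 < γ i := (Finset.mem_filter.1 hi).2
    have := Finset.single_le_sum (f := γ) (fun j _ => Nat.zero_le _) (Finset.mem_univ i)
    omega
  set α : ℝ := 1 / ((m:ℝ) + 1) with hα
  have hα0 : 0 < α := by positivity
  have hα1 : α ≤ 1/2 := by
    have : (1:ℝ) ≤ m := by exact_mod_cast hm1
    rw [hα, div_le_div_iff₀ (by positivity) (by positivity)]; linarith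
  refine ⟨_, ((ev1.and ev2).and (ev3.and ev4)).and (ev5.and hfu.eventually_nhds), α, ⟨hα0, hα1⟩,
    (2*a)^(1-α) * (a/4)⁻¹, by positivity, ?_⟩
  rintro x ⟨⟨⟨x1, x2⟩, x3, x4⟩, x5, x6⟩
  obtain ⟨i, hiS, hmin⟩ := S.exists_min_image (fun i => |x i|) hSne
  have hγi : 1 ≤ γ i := (Finset.mem_filter.1 hiS).2
  set s := |x i| with hs
  set P := |mono γ x| with hP
  set G := ‖fderiv ℝ f x‖ with hG
  have hfx : |f x| = P * |u x| := by rw [x6.self_of_nhds, abs_mul]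
  have hs1 : s ≤ ‖x‖ := by simpa using norm_le_pi_norm x i
  have hsP : s ^ (m+1) ≤ P := by
    have h1 : s ≤ 1 := hs1.trans (x4.le.trans (min_le_left _ _))
    have h2 : s ^ m ≤ P := by
      rw [hP, mono, Finset.abs_prod, hm, ← Finset.prod_pow_eq_pow_sum]
      apply Finset.prod_le_prod
      · intros; positivity
      · intro j _
        rw [abs_pow]
        rcases Nat.eq_zero_or_pos (γ j) with hj | hj
        · simp [hj]
        · exact pow_le_pow_left₀ (abs_nonneg _) (hmin j (by simp [hS, hj])) _
    exact (pow_le_pow_of_le_one (abs_nonneg _) h1 (Nat.le_succ m)).trans h2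
  have hmain : P * (a/4) ≤ G * s := by
    set v : Fin n → ℝ := Pi.single i (x i) with hv
    have hvn : ‖v‖ = s := by rw [hv, Pi.norm_single, Real.norm_eq_abs]
    have hfd : HasDerivAt (fun t : ℝ => f (x + t • v)) (fderiv ℝ f x v) 0 := by
      have hdf : DifferentiableAt ℝ f x := by
        have : DifferentiableAt ℝ (fun y => mono γ y * u y) x := by
          unfold mono
          fun_prop
        exact this.congr_of_eventuallyEq x6
      have h1 : HasDerivAt (fun t : ℝ => x + t • v) v 0 := by
        simpa using ((hasDerivAt_id (0:ℝ)).smul_const v).const_add x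
      exact HasFDerivAt.comp_hasDerivAt (f := fun t : ℝ => x + t • v) 0
        (by simpa using hdf.hasFDerivAt) h1
    have hfd2 : HasDerivAt (fun t : ℝ => (1+t)^(γ i) * (mono γ x * u (x + t • v)))
        ((γ i : ℝ) * (mono γ x * u x) + mono γ x * fderiv ℝ u x v) 0 := by
      have h1 : HasDerivAt (fun t : ℝ => x + t • v) v 0 := by
        simpa using ((hasDerivAt_id (0:ℝ)).smul_const v).const_add x
      have h2 : HasDerivAt (fun t : ℝ => u (x + t • v)) (fderiv ℝ u x v) 0 :=
        HasFDerivAt.comp_hasDerivAt (f := fun t : ℝ => x + t • v) 0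
          (by simpa using x5.hasFDerivAt) h1
      have h3 : HasDerivAt (fun t : ℝ => (1+t)^(γ i)) (γ i : ℝ) 0 := by
        simpa using ((hasDerivAt_id (0:ℝ)).const_add 1).fun_pow (γ i)
      simpa using h3.fun_mul (h2.const_mul (mono γ x))
    have hmono : ∀ t : ℝ, mono γ (x + t • v) = (1+t)^(γ i) * mono γ x := by
      intro t
      unfold mono
      rw [← Finset.mul_prod_erase _ _ (Finset.mem_univ i),
        ← Finset.mul_prod_erase _ (fun j => x j ^ γ j) (Finset.mem_univ i), ← mul_assoc, ← mul_pow]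
      congr 1
      · congr 1
        simp [hv]; ring
      · apply Finset.prod_congr rfl
        intro j hj
        simp [hv, Finset.ne_of_mem_erase hj]
    have heq : (fun t : ℝ => f (x + t • v)) =ᶠ[𝓝 0]
        (fun t : ℝ => (1+t)^(γ i) * (mono γ x * u (x + t • v))) := by
      have : Tendsto (fun t : ℝ => x + t • v) (𝓝 0) (𝓝 x) := by
        have : Continuous (fun t : ℝ => x + t • v) := by fun_prop
        simpa using this.tendsto 0
      filter_upwards [this.eventually x6] with t ht
      rw [ht, hmono, mul_assoc]
    have hder := hfd.unique (hfd2.congr_of_eventuallyEq heq)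
    have hG2 : |fderiv ℝ f x v| ≤ G * s := by
      rw [← hvn]; exact (fderiv ℝ f x).le_opNorm v
    have hu2 : |fderiv ℝ u x v| ≤ a / 4 := by
      have h1 : |fderiv ℝ u x v| ≤ ‖fderiv ℝ u x‖ * ‖v‖ := (fderiv ℝ u x).le_opNorm v
      have h2 : ‖v‖ ≤ a / (4*K) := by rw [hvn]; exact hs1.trans (x4.le.trans (min_le_right _ _))
      calc _ ≤ ‖fderiv ℝ u x‖ * ‖v‖ := h1
        _ ≤ K * (a / (4*K)) := by gcongr
        _ = a / 4 := by field_simp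
    have h3 : a/4 ≤ |(γ i : ℝ) * u x + fderiv ℝ u x v| := by
      have h4 : |(γ i : ℝ) * u x| ≤ |(γ i : ℝ) * u x + fderiv ℝ u x v| + |fderiv ℝ u x v| := by
        have := abs_sub ((γ i : ℝ) * u x + fderiv ℝ u x v) (fderiv ℝ u x v)
        simpa using this
      have h5 : |u x| ≤ |(γ i : ℝ) * u x| := by
        rw [abs_mul, Nat.abs_cast]
        have : (1:ℝ) ≤ γ i := by exact_mod_cast hγi
        nlinarith [abs_nonneg (u x)]
      linarith
    calc P * (a/4) ≤ P * |(γ i : ℝ) * u x + fderiv ℝ u x v| := by gcongr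
      _ = |fderiv ℝ f x v| := by rw [hder, hP, ← abs_mul]; congr 1; ring
      _ ≤ G * s := hG2
  rcases (abs_nonneg (mono γ x)).eq_or_lt' with hP0 | hP0
  · have : |f x| = 0 := by rw [hfx, hP, hP0, zero_mul]
    rw [this, Real.zero_rpow (by linarith)]
    positivity
  · have hsα : s ≤ P ^ α := by
      have : s = (s^(m+1)) ^ α := by
        rw [hα, ← Real.rpow_natCast, ← Real.rpow_mul (abs_nonneg _)]
        push_cast
        rw [mul_one_div_cancel hmm.ne', Real.rpow_one]
      rw [this]
      exact Real.rpow_le_rpow (by positivity) hsP hα0.le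
    have hPP : P ^ (1-α) * P ^ α = P := by
      rw [← Real.rpow_add hP0]; simp [hP]
    have hPα : 0 < P ^ α := Real.rpow_pos_of_pos hP0 _
    have h6 : P ^ (1-α) * (a/4) ≤ G := by
      have : (P ^ (1-α) * (a/4)) * P ^ α ≤ G * P ^ α := by
        calc _ = P * (a/4) := by rw [mul_right_comm, hPP]
          _ ≤ G * s := hmain
          _ ≤ _ := by gcongr
      exact le_of_mul_le_mul_right this hPα
    rw [hfx, Real.mul_rpow (abs_nonneg _) (abs_nonneg _)]
    calc P ^ (1-α) * |u x| ^ (1-α) ≤ (G / (a/4)) * (2*a)^(1-α) := by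
          have : P ^ (1-α) ≤ G / (a/4) := by rw [le_div_iff₀ (by positivity)]; exact h6
          have h7 : |u x| ^ (1-α) ≤ (2*a)^(1-α) :=
            Real.rpow_le_rpow (abs_nonneg _) x2.le (by linarith)
          gcongr
      _ = _ := by rw [div_eq_mul_inv]; ring

end Loj

namespace Loj
open Filter Topology Set
set_option linter.unusedSectionVars false

section mono
variable {n : ℕ}

theorem mono_add (γ δ : Fin n → ℕ) (x : Fin n → ℝ) : mono (γ + δ) x = mono γ x * mono δ x := by
  simp [mono, pow_add, Finset.prod_mul_distrib]

theorem mono_smul (k : ℕ) (γ : Fin n → ℕ) (x : Fin n → ℝ) : mono (k • γ) x = (mono γ x) ^ k := by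
  simp [mono, Finset.prod_pow, pow_mul', ]

theorem mono_zero (x : Fin n → ℝ) : mono 0 x = 1 := by simp [mono]

theorem mono_single (i : Fin n) (x : Fin n → ℝ) : mono (Pi.single i 1) x = x i := by
  unfold mono
  rw [Finset.prod_eq_single i]
  · simp
  · intro j _ hj; simp [hj]
  · simp

theorem mono_at_zero {γ : Fin n → ℕ} (h : γ ≠ 0) : mono γ 0 = 0 := by
  obtain ⟨i, hi⟩ := Function.ne_iff.1 h
  exact Finset.prod_eq_zero (Finset.mem_univ i) (by simpa using hi)

theorem analyticAt_mono (γ : Fin n → ℕ) (x : Fin n → ℝ) : AnalyticAt ℝ (mono γ) x := by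
  unfold mono
  have : ∀ i, AnalyticAt ℝ (fun x : Fin n → ℝ => x i) x := fun i =>
    (ContinuousLinearMap.proj (R := ℝ) (φ := fun _ : Fin n => ℝ) i).analyticAt x
  exact Finset.analyticAt_fun_prod _ fun i _ => (this i).pow _

theorem analyticAt_coord (i : Fin n) (x : Fin n → ℝ) :
    AnalyticAt ℝ (fun x : Fin n → ℝ => x i) x :=
  (ContinuousLinearMap.proj (R := ℝ) (φ := fun _ : Fin n => ℝ) i).analyticAt x

theorem mono_not_zero (γ : Fin n → ℕ) : ¬ ∀ᶠ x in 𝓝 (0 : Fin n → ℝ), mono γ x = 0 := by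
  intro h
  have hc : Tendsto (fun t : ℝ => (fun _ : Fin n => t)) (𝓝 0) (𝓝 0) := by
    have : Continuous (fun t : ℝ => (fun _ : Fin n => t)) := by fun_prop
    exact this.tendsto 0
  have h2 := (hc.eventually h)
  have h3 : ∀ᶠ t in 𝓝[≠] (0:ℝ), mono γ (fun _ => t) = 0 := h2.filter_mono nhdsWithin_le_nhds
  obtain ⟨t, ht, ht0⟩ := (h3.and self_mem_nhdsWithin).exists
  have : mono γ (fun _ => t) ≠ 0 := by
    unfold mono
    exact Finset.prod_ne_zero_iff.2 fun i _ => pow_ne_zero _ ht0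
  exact this ht

theorem exists_single_add {δ : Fin n → ℕ} {i : Fin n} (hi : δ i ≠ 0) :
    ∃ δ' : Fin n → ℕ, δ = Pi.single i 1 + δ' := by
  refine ⟨fun j => δ j - (Pi.single i 1 : Fin n → ℕ) j, ?_⟩
  funext j
  by_cases hj : j = i
  · subst hj
    simp only [Pi.add_apply, Pi.single_eq_same]
    omega
  · simp [hj]

/-- cancel a monomial in an equality of germs -/
theorem mono_cancel (γ : Fin n → ℕ) {f g : (Fin n → ℝ) → ℝ} (hf : AnalyticAt ℝ f 0)
    (hg : AnalyticAt ℝ g 0) (h : ∀ᶠ x in 𝓝 0, mono γ x * f x = mono γ x * g x) :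
    ∀ᶠ x in 𝓝 0, f x = g x := by
  have := mul_eq_zero_germ (analyticAt_mono γ 0) (hf.fun_sub hg)
    (h.mono fun x hx => by rw [mul_sub, hx, sub_self])
  exact (this.resolve_left (mono_not_zero γ)).mono fun x hx => sub_eq_zero.1 hx

/-- projection to the hyperplane -/
theorem exists_proj (i : Fin n) : ∃ π : (Fin n → ℝ) →L[ℝ] (Fin n → ℝ),
    ∀ x, π x = x - x i • (Pi.single i 1 : Fin n → ℝ) :=
  ⟨ContinuousLinearMap.id ℝ _ -
    (ContinuousLinearMap.proj (R := ℝ) (φ := fun _ : Fin n => ℝ) i).smulRight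
      (Pi.single i 1 : Fin n → ℝ), fun x => by simp⟩

theorem div_coord (i : Fin n) {f : (Fin n → ℝ) → ℝ} (hf : AnalyticAt ℝ f 0)
    (h : ∀ᶠ x in 𝓝 (0 : Fin n → ℝ), x i = 0 → f x = 0) :
    ∃ g, AnalyticAt ℝ g 0 ∧ ∀ᶠ x in 𝓝 (0 : Fin n → ℝ), f x = x i * g x := by
  obtain ⟨π, hπ⟩ := exists_proj i
  obtain ⟨g, hg, hfg⟩ := hadamard_division
    (ContinuousLinearMap.proj (R := ℝ) (φ := fun _ : Fin n => ℝ) i) (Pi.single i 1) π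
    (by simpa using hπ) hf
  have ht : Tendsto π (𝓝 0) (𝓝 0) := by simpa using π.continuous.tendsto 0
  refine ⟨g, hg, ?_⟩
  filter_upwards [hfg, ht.eventually h] with x h1 h2
  rw [h1, h2 (by simp [hπ])]
  simp

theorem BE.factor : ∀ (N : ℕ) (δ : Fin n → ℕ), ∑ i, δ i = N →
    ∀ (e H w : (Fin n → ℝ) → ℝ), AnalyticAt ℝ e 0 → AnalyticAt ℝ H 0 → AnalyticAt ℝ w 0 → w 0 ≠ 0 →
    (∀ᶠ x in 𝓝 0, e x * H x = mono δ x * w x) → BE n e ∧ BE n H := by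
  have hmul : ∀ (i : Fin n) (f g : (Fin n → ℝ) → ℝ), BE n g →
      (∀ᶠ x in 𝓝 (0 : Fin n → ℝ), f x = x i * g x) → BE n f := by
    rintro i f g ⟨γ, u, hu, hu0, hg⟩ hf
    refine ⟨Pi.single i 1 + γ, u, hu, hu0, ?_⟩
    filter_upwards [hg, hf] with x h1 h2
    rw [h2, h1, mono_add, mono_single, mul_assoc]
  intro N
  induction N with
  | zero =>
    intro δ hδ e H w he hH hw hw0 h
    have hδ0 : δ = 0 := by
      ext i
      have := (Finset.sum_eq_zero_iff.1 hδ) i (Finset.mem_univ i)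
      simpa using this
    have := h.self_of_nhds
    rw [hδ0, mono_zero, one_mul] at this
    have h2 : e 0 * H 0 ≠ 0 := by rw [this]; exact hw0
    exact ⟨⟨0, e, he, left_ne_zero_of_mul h2, .of_forall fun x => by simp [mono_zero]⟩,
      ⟨0, H, hH, right_ne_zero_of_mul h2, .of_forall fun x => by simp [mono_zero]⟩⟩
  | succ N ih =>
    intro δ hδ e H w he hH hw hw0 h
    obtain ⟨i, hi⟩ : ∃ i, δ i ≠ 0 := by
      by_contra hne
      push Not at hne
      simp [hne] at hδ
    obtain ⟨δ', rfl⟩ := exists_single_add hi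
    have hδ' : ∑ i, δ' i = N := by
      simp [Finset.sum_add_distrib] at hδ; omega
    obtain ⟨π, hπ⟩ := exists_proj i
    have ht : Tendsto π (𝓝 0) (𝓝 0) := by simpa using π.continuous.tendsto 0
    have hπa : AnalyticAt ℝ π 0 := π.analyticAt 0
    have hπfix : ∀ x : Fin n → ℝ, x i = 0 → π x = x := by intro x hx; simp [hπ, hx]
    have hπi : ∀ x : Fin n → ℝ, π x i = 0 := by intro x; simp [hπ]
    have hz := mul_eq_zero_germ (f := fun x => e (π x)) (g := fun x => H (π x))
      (AnalyticAt.fun_comp (by simpa using he) hπa) (AnalyticAt.fun_comp (by simpa using hH) hπa)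
      (by
        filter_upwards [ht.eventually h] with x hx
        rw [hx, mono_add, mono_single, hπi]; simp)
    rcases hz with hz | hz
    · obtain ⟨g, hg, heg⟩ := div_coord i he (hz.mono fun x hx hxi => by rwa [hπfix x hxi] at hx)
      have hc := mono_cancel (Pi.single i 1) (hg.fun_mul hH) ((analyticAt_mono δ' 0).fun_mul hw) (by
        filter_upwards [h, heg] with x h1 h2
        rw [h2, mono_add, mono_single] at h1
        rw [mono_single]; linarith)
      obtain ⟨r1, r2⟩ := ih δ' hδ' g H w hg hH hw hw0 hc
      exact ⟨hmul i e g r1 heg, r2⟩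
    · obtain ⟨g, hg, heg⟩ := div_coord i hH (hz.mono fun x hx hxi => by rwa [hπfix x hxi] at hx)
      have hc := mono_cancel (Pi.single i 1) (he.fun_mul hg) ((analyticAt_mono δ' 0).fun_mul hw) (by
        filter_upwards [h, heg] with x h1 h2
        rw [h2, mono_add, mono_single] at h1
        rw [mono_single]; linarith)
      obtain ⟨r1, r2⟩ := ih δ' hδ' e g w he hg hw hw0 hc
      exact ⟨r1, hmul i H g r2 heg⟩

theorem le_of_coord_ne (i : Fin n) {f g : (Fin n → ℝ) → ℝ}
    (hf : ∀ᶠ x in 𝓝 (0 : Fin n → ℝ), ContinuousAt f x)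
    (hg : ∀ᶠ x in 𝓝 (0 : Fin n → ℝ), ContinuousAt g x)
    (h : ∀ᶠ x in 𝓝 (0 : Fin n → ℝ), x i ≠ 0 → f x ≤ g x) :
    ∀ᶠ x in 𝓝 (0 : Fin n → ℝ), f x ≤ g x := by
  filter_upwards [hf, hg, h.eventually_nhds] with x h1 h2 h3
  by_cases hx : x i = 0
  · have hc : Tendsto (fun t : ℝ => x + t • (Pi.single i 1 : Fin n → ℝ)) (𝓝[≠] 0) (𝓝 x) := by
      have : Continuous (fun t : ℝ => x + t • (Pi.single i 1 : Fin n → ℝ)) := by fun_prop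
      have := this.tendsto 0
      simp only [zero_smul, add_zero] at this
      exact this.mono_left nhdsWithin_le_nhds
    refine le_of_tendsto_of_tendsto (h1.tendsto.comp hc) (h2.tendsto.comp hc) ?_
    filter_upwards [hc.eventually h3, self_mem_nhdsWithin] with t h4 h5
    apply h4
    simpa [hx] using h5
  · exact h3.self_of_nhds hx

theorem div_mono : ∀ (N : ℕ) (ρ : Fin n → ℕ), ∑ i, ρ i = N →
    ∀ (a : (Fin n → ℝ) → ℝ) (C : ℝ), AnalyticAt ℝ a 0 →
    (∀ᶠ x in 𝓝 0, |a x| ≤ C * |mono ρ x|) →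
    ∃ b, AnalyticAt ℝ b 0 ∧ ∀ᶠ x in 𝓝 0, a x = mono ρ x * b x := by
  intro N
  induction N with
  | zero =>
    intro δ hδ a C ha h
    have hδ0 : δ = 0 := by
      ext i
      have := (Finset.sum_eq_zero_iff.1 hδ) i (Finset.mem_univ i)
      simpa using this
    exact ⟨a, ha, .of_forall fun x => by simp [hδ0, mono_zero]⟩
  | succ N ih =>
    intro δ hδ a C ha h
    obtain ⟨i, hi⟩ : ∃ i, δ i ≠ 0 := by
      by_contra hne
      push Not at hne
      simp [hne] at hδ
    obtain ⟨δ', rfl⟩ := exists_single_add hi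
    have hδ' : ∑ i, δ' i = N := by
      simp [Finset.sum_add_distrib] at hδ; omega
    obtain ⟨g, hg, hag⟩ := div_coord i ha (by
      filter_upwards [h] with x hx hxi
      rw [mono_add, mono_single, hxi] at hx
      simpa using hx)
    have hb : ∀ᶠ x in 𝓝 (0 : Fin n → ℝ), |g x| ≤ C * |mono δ' x| := by
      apply le_of_coord_ne i (hg.eventually_analyticAt.mono fun x hx => hx.continuousAt.abs)
      · exact .of_forall fun x => continuousAt_const.mul (analyticAt_mono δ' x).continuousAt.abs
      · filter_upwards [h, hag] with x h1 h2 h3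
        rw [h2, mono_add, mono_single, abs_mul, abs_mul] at h1
        have : 0 < |x i| := abs_pos.2 h3
        refine le_of_mul_le_mul_left ?_ this
        linarith
    obtain ⟨b, hb, hgb⟩ := ih δ' hδ' g C hg hb
    refine ⟨b, hb, ?_⟩
    filter_upwards [hag, hgb] with x h1 h2
    rw [h1, h2, mono_add, mono_single, mul_assoc]

end mono

section cover
variable {X : Type*} [NormedAddCommGroup X] [NormedSpace ℝ X]

theorem cover_single {φ ψ : X → X} (hψ : ContinuousAt ψ 0) (hψ0 : ψ 0 = 0)
    (h : ∀ᶠ x in 𝓝 0, φ (ψ x) = x) : Cover (fun _ : Unit => φ) := by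
  intro p _ hmono _ hW
  obtain ⟨W, hW, hp⟩ := hW ()
  have : ∀ᶠ x in 𝓝 0, ψ x ∈ W := hψ.eventually (by rwa [hψ0])
  refine ⟨_, this.and h, hmono _ _ ?_ hp⟩
  rintro x ⟨h1, h2⟩
  exact ⟨ψ x, h1, h2⟩

theorem cover_prod {ι : Type} {φ : ι → X → X} (h : Cover φ) :
    Cover (fun i (p : ℝ × X) => (p.1, φ i p.2)) := by
  intro p h0 hmono hunion hW
  obtain ⟨V, hV, r, hr, hp⟩ := h (fun S => ∃ r > (0:ℝ), p (Metric.ball (0:ℝ) r ×ˢ S))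
    ⟨1, one_pos, by simpa using h0⟩
    (by
      rintro s t hst ⟨r, hr, hp⟩
      exact ⟨r, hr, hmono _ _ (Set.prod_mono_right hst) hp⟩)
    (by
      rintro s t ⟨r, hr, hp⟩ ⟨r', hr', hp'⟩
      refine ⟨min r r', lt_min hr hr', hmono _ _ ?_ (hunion _ _ hp hp')⟩
      rintro ⟨z, x⟩ ⟨hz, hx | hx⟩
      · exact Or.inl ⟨Metric.ball_subset_ball (min_le_left _ _) hz, hx⟩
      · exact Or.inr ⟨Metric.ball_subset_ball (min_le_right _ _) hz, hx⟩)
    (by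
      intro i
      obtain ⟨W, hW, hp⟩ := hW i
      obtain ⟨r, hr, hrW⟩ := Metric.mem_nhds_iff.1 hW
      refine ⟨Metric.ball 0 r, Metric.ball_mem_nhds _ hr, r, hr, hmono _ _ ?_ hp⟩
      rintro ⟨z, x⟩ ⟨hz, y, hy, rfl⟩
      refine ⟨(z, y), hrW ?_, rfl⟩
      rw [Prod.zero_eq_mk, ← ball_prod_same]
      exact ⟨hz, hy⟩)
  exact ⟨_, prod_mem_nhds (Metric.ball_mem_nhds _ hr) hV, hp⟩

theorem cover_of_finite {ι : Type} [Finite ι] {φ : ι → X → X}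
    (h : ∀ W ∈ 𝓝 (0:X), (⋃ i, φ i '' W) ∈ 𝓝 (0:X)) : Cover φ := by
  intro p h0 hmono hunion hW
  choose W hW hp using hW
  have hI : (⋂ i, W i) ∈ 𝓝 (0:X) := Filter.iInter_mem.2 hW
  refine ⟨_, h _ hI, ?_⟩
  cases nonempty_fintype ι
  have : ∀ s : Finset ι, p (⋃ i ∈ s, φ i '' (⋂ i, W i)) := by
    classical
    intro s
    induction s using Finset.induction_on with
    | empty => simpa using h0
    | insert a s ha ih =>
      rw [Finset.set_biUnion_insert]
      exact hunion _ _ (hmono _ _ (image_mono (iInter_subset _ _)) (hp a)) ih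
  simpa using this Finset.univ

/-- sign -/
def sgn (b : Bool) : ℝ := if b then 1 else -1

theorem cover_pow {n : ℕ} (N : ℕ) (hN : N ≠ 0) :
    Cover (fun (ε : Fin n → Bool) (y : Fin n → ℝ) => fun j => sgn (ε j) * y j ^ N) := by
  apply cover_of_finite
  intro W hW
  obtain ⟨r, hr, hrW⟩ := Metric.mem_nhds_iff.1 hW
  refine mem_of_superset (Metric.ball_mem_nhds (0 : Fin n → ℝ) (pow_pos hr N)) ?_
  intro x hx
  rw [mem_ball_zero_iff] at hx
  refine mem_iUnion.2 ⟨fun j => decide (0 ≤ x j), fun j => |x j| ^ ((N:ℝ)⁻¹), hrW ?_, ?_⟩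
  · rw [mem_ball_zero_iff, pi_norm_lt_iff hr]
    intro j
    have h1 : |x j| < r ^ N := lt_of_le_of_lt (by simpa using norm_le_pi_norm x j) hx
    rw [Real.norm_of_nonneg (by positivity)]
    refine lt_of_pow_lt_pow_left₀ N hr.le ?_
    rwa [Real.rpow_inv_natCast_pow (abs_nonneg _) hN]
  · ext j
    simp only
    rw [Real.rpow_inv_natCast_pow (abs_nonneg _) hN]
    by_cases hj : 0 ≤ x j
    · simp [sgn, hj, abs_of_nonneg]
    · simp [sgn, hj, abs_of_neg (not_le.1 hj)]

/-- charts of the blow-up of `z = x i = 0` -/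
def blow {n : ℕ} (i : Fin n) : Option ℝ → ℝ × (Fin n → ℝ) → ℝ × (Fin n → ℝ)
  | none => fun p => (p.1, Function.update p.2 i (p.1 * p.2 i))
  | some c => fun p => (p.2 i * (c + p.1), p.2)

theorem cover_blow {n : ℕ} (i : Fin n) : Cover (blow i) := by
  intro p h0 hmono hunion hW
  obtain ⟨W0, hW0, hp0⟩ := hW none
  obtain ⟨η, hη, hηW⟩ := Metric.mem_nhds_iff.1 hW0
  have hK : IsCompact (Icc (-(2/η)) (2/η)) := isCompact_Icc
  obtain ⟨r, hr, hpr⟩ := hK.induction_on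
    (p := fun s => ∃ r > (0:ℝ), p {q | ‖q.2‖ < r ∧ ∃ c ∈ s, q.1 = q.2 i * c})
    ⟨1, one_pos, by simpa using h0⟩
    (by
      rintro s t hst ⟨r, hr, hp⟩
      refine ⟨r, hr, hmono _ _ ?_ hp⟩
      rintro q ⟨hq, c, hc, h⟩
      exact ⟨hq, c, hst hc, h⟩)
    (by
      rintro s t ⟨r, hr, hp⟩ ⟨r', hr', hp'⟩
      refine ⟨min r r', lt_min hr hr', hmono _ _ ?_ (hunion _ _ hp hp')⟩
      rintro q ⟨hq, c, hc | hc, h⟩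
      · exact Or.inl ⟨hq.trans_le (min_le_left _ _), c, hc, h⟩
      · exact Or.inr ⟨hq.trans_le (min_le_right _ _), c, hc, h⟩)
    (by
      intro c _
      obtain ⟨W, hW, hp⟩ := hW (some c)
      obtain ⟨r, hr, hrW⟩ := Metric.mem_nhds_iff.1 hW
      refine ⟨Metric.ball c r, mem_nhdsWithin_of_mem_nhds (Metric.ball_mem_nhds _ hr), r, hr,
        hmono _ _ ?_ hp⟩
      rintro ⟨z, x⟩ ⟨hq, c', hc', h⟩
      refine ⟨(c' - c, x), hrW ?_, ?_⟩
      · rw [Prod.zero_eq_mk, ← ball_prod_same]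
        refine ⟨?_, by simpa using hq⟩
        rw [mem_ball_zero_iff]
        rwa [Metric.mem_ball, dist_eq_norm] at hc'
      · simp only [blow] at *
        simp [h])
  refine ⟨Metric.ball 0 (min η r), Metric.ball_mem_nhds _ (lt_min hη hr),
    hmono _ _ ?_ (hunion _ _ hp0 hpr)⟩
  rintro ⟨z, x⟩ hq
  rw [Prod.zero_eq_mk, ← ball_prod_same] at hq
  obtain ⟨hz, hx⟩ := hq
  simp only [mem_ball_zero_iff, lt_min_iff, Real.norm_eq_abs] at hz hx
  by_cases hc : |x i| ≤ η / 2 * |z|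
  · left
    refine ⟨(z, Function.update x i (x i / z)), hηW ?_, ?_⟩
    · rw [Prod.zero_eq_mk, ← ball_prod_same]
      refine ⟨by simpa using hz.1, ?_⟩
      rw [mem_ball_zero_iff, pi_norm_lt_iff hη]
      intro j
      by_cases hj : j = i
      · subst hj
        simp only [Function.update_self, Real.norm_eq_abs, abs_div]
        rcases eq_or_ne z 0 with rfl | hz0
        · simpa using hη
        · rw [div_lt_iff₀ (abs_pos.2 hz0)]
          have := abs_pos.2 hz0
          nlinarith
      · simp only [Function.update_of_ne hj]
        exact (norm_le_pi_norm x j).trans_lt hx.1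
    · simp only [blow, Function.update_self, Function.update_idem]
      congr 1
      rcases eq_or_ne z 0 with rfl | hz0
      · have : x i = 0 := by simpa using hc
        rw [zero_mul, ← this, Function.update_eq_self]
      · rw [mul_div_cancel₀ _ hz0, Function.update_eq_self]
  · right
    push Not at hc
    refine ⟨hx.2, z / x i, ?_, ?_⟩
    · have hxi : 0 < |x i| := lt_of_le_of_lt (by positivity) hc
      rw [mem_Icc, ← abs_le, abs_div, div_le_div_iff₀ hxi hη]
      linarith
    · have hxi : x i ≠ 0 := by
        intro h
        rw [h, abs_zero] at hc
        have : 0 ≤ η / 2 * |z| := by positivity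
        linarith
      simp only
      field_simp

end cover

end Loj

namespace Loj
open Filter Topology Set
variable {n : ℕ}

theorem BX.congr {f g : ℝ × (Fin n → ℝ) → ℝ} (h : BX n f) (hg : ∀ᶠ x in 𝓝 0, g x = f x) :
    BX n g := by
  obtain ⟨m, γ, u, hu, hu0, h⟩ := h
  exact ⟨m, γ, u, hu, hu0, by filter_upwards [h, hg] with x h1 h2; rw [h2, h1]⟩

theorem BX.unit_mul {f u : ℝ × (Fin n → ℝ) → ℝ} (h : BX n f) (hu : AnalyticAt ℝ u 0)
    (hu0 : u 0 ≠ 0) : BX n (fun x => u x * f x) := by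
  obtain ⟨m, γ, v, hv, hv0, h⟩ := h
  refine ⟨m, γ, fun p => u p * v p, hu.fun_mul hv, mul_ne_zero hu0 hv0, ?_⟩
  filter_upwards [h] with x h1
  rw [h1]; ring

theorem an_snd {a : (Fin n → ℝ) → ℝ} (ha : AnalyticAt ℝ a 0) :
    AnalyticAt ℝ (fun p : ℝ × (Fin n → ℝ) => a p.2) 0 :=
  AnalyticAt.fun_comp (g := a) (f := Prod.snd) (x := (0 : ℝ × (Fin n → ℝ))) ha analyticAt_snd

theorem an_comp {Y Z : Type*} [NormedAddCommGroup Y] [NormedSpace ℝ Y] [NormedAddCommGroup Z]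
    [NormedSpace ℝ Z] {a : Z → ℝ} (ha : AnalyticAt ℝ a 0) {φ : Y → Z}
    (hφ : AnalyticAt ℝ φ 0) (h0 : φ 0 = 0) : AnalyticAt ℝ (fun p => a (φ p)) 0 :=
  AnalyticAt.fun_comp (g := a) (f := φ) (by rwa [h0]) hφ

theorem order_lt : ∀ (N : ℕ) (c : ℕ → ℝ) (v : ℝ → ℝ), AnalyticAt ℝ v 0 → (∃ k < N, c k ≠ 0) →
    ∃ d < N, analyticOrderAt (fun z : ℝ => ∑ k ∈ Finset.range N, c k * z ^ k + z ^ N * v z) 0 = d := by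
  intro N
  induction N with
  | zero => rintro c v _ ⟨k, hk, _⟩; omega
  | succ N ih =>
    rintro c v hv ⟨k, hk, hck⟩
    have han : AnalyticAt ℝ
        (fun z : ℝ => ∑ k ∈ Finset.range (N+1), c k * z ^ k + z ^ (N+1) * v z) 0 := by fun_prop
    by_cases h0 : c 0 = 0
    · obtain ⟨k, rfl⟩ : ∃ k', k = k' + 1 := by
        cases k with
        | zero => exact absurd h0 hck
        | succ k => exact ⟨k, rfl⟩
      obtain ⟨d, hd, hord⟩ := ih (fun k => c (k+1)) v hv ⟨k, by omega, hck⟩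
      refine ⟨d+1, by omega, ?_⟩
      have heq : (fun z : ℝ => ∑ k ∈ Finset.range (N+1), c k * z ^ k + z ^ (N+1) * v z) =
          (fun z => z) * (fun z => ∑ k ∈ Finset.range N, c (k+1) * z ^ k + z ^ N * v z) := by
        funext z
        simp only [Pi.mul_apply]
        rw [Finset.sum_range_succ', h0, mul_add, Finset.mul_sum]
        simp only [zero_mul, add_zero]
        congr 1
        · exact Finset.sum_congr rfl fun k _ => by ring
        · ring
      have hid : AnalyticAt ℝ (fun z : ℝ => z) 0 := analyticAt_id
      have han2 : AnalyticAt ℝ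
        (fun z : ℝ => ∑ k ∈ Finset.range N, c (k+1) * z ^ k + z ^ N * v z) 0 := by fun_prop
      rw [heq, analyticOrderAt_mul hid han2, hord]
      have : analyticOrderAt (fun z : ℝ => z) 0 = 1 := analyticOrderAt_id
      rw [this, add_comm]; norm_cast
    · refine ⟨0, by omega, ?_⟩
      rw [Nat.cast_zero, han.analyticOrderAt_eq_zero, Finset.sum_range_succ']
      simpa using h0

/-- the claim for functions of order `d` in the distinguished variable -/
def SS (n d : ℕ) : Prop := ∀ (γ : Fin n → ℕ) (g : ℝ × (Fin n → ℝ) → ℝ), AnalyticAt ℝ g 0 →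
  analyticOrderAt (fun z : ℝ => g (z, 0)) 0 = d → Unif (BX n) (fun p => mono γ p.2 * g p)

theorem mono_update (γ : Fin n → ℕ) (i : Fin n) (z : ℝ) (y : Fin n → ℝ) :
    mono γ (Function.update y i (z * y i)) = z ^ γ i * mono γ y := by
  unfold mono
  rw [← Finset.mul_prod_erase _ _ (Finset.mem_univ i),
    ← Finset.mul_prod_erase _ (fun j => y j ^ γ j) (Finset.mem_univ i), ← mul_assoc, ← mul_pow]
  congr 1
  · simp
  · apply Finset.prod_congr rfl
    intro j hj
    simp [Finset.ne_of_mem_erase hj]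

theorem blow_zero (i : Fin n) (o : Option ℝ) : blow i o 0 = 0 := by
  cases o with
  | none => simp [blow]
  | some c => simp [blow]

theorem blow_analytic (i : Fin n) (o : Option ℝ) : AnalyticAt ℝ (blow i o) 0 := by
  have hsnd : ∀ j : Fin n, AnalyticAt ℝ (fun p : ℝ × (Fin n → ℝ) => p.2 j) 0 := fun j =>
    an_snd (analyticAt_coord j 0)
  cases o with
  | none =>
    refine analyticAt_fst.prod (AnalyticAt.pi fun j => ?_)
    by_cases hj : j = i
    · subst hj
      simpa using analyticAt_fst.fun_mul (hsnd j)
    · simpa [hj] using hsnd j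
  | some c =>
    exact ((hsnd i).fun_mul (analyticAt_const.fun_add analyticAt_fst)).prod analyticAt_snd

theorem blow_unif (m : ℕ) (IH : ∀ d ≤ m, SS n d) : ∀ (N : ℕ) (β : Fin n → ℕ), ∑ i, β i = N →
    ∀ (γ : Fin n → ℕ) (b : ℕ → (Fin n → ℝ) → ℝ) (u : ℝ × (Fin n → ℝ) → ℝ),
    (∀ k, AnalyticAt ℝ (b k) 0) → AnalyticAt ℝ u 0 → u 0 ≠ 0 → (∃ k < m, b k 0 ≠ 0) →
    Unif (BX n) (fun p => mono γ p.2 * (∑ k ∈ Finset.range m,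
      mono ((m+1-k) • β) p.2 * b k p.2 * p.1 ^ k + p.1 ^ (m+1) * u p)) := by
  intro N
  have hbr : ∀ (c : ℝ) (β : Fin n → ℕ) (b : ℕ → (Fin n → ℝ) → ℝ) (u : ℝ × (Fin n → ℝ) → ℝ),
    (∀ k, AnalyticAt ℝ (b k) 0) → AnalyticAt ℝ u 0 → AnalyticAt ℝ
      (fun p : ℝ × (Fin n → ℝ) => (∑ k ∈ Finset.range m,
      mono ((m+1-k) • β) p.2 * b k p.2 * (c + p.1) ^ k + (c + p.1) ^ (m+1) * u p)) 0 := by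
    intro c β b u hb hu
    have h1 : ∀ k, AnalyticAt ℝ (fun p : ℝ × (Fin n → ℝ) => (c + p.1)^k) 0 := fun k =>
      (analyticAt_const.fun_add analyticAt_fst).fun_pow k
    refine AnalyticAt.fun_add (Finset.analyticAt_fun_sum _ fun k _ => ?_) ((h1 _).fun_mul hu)
    exact ((an_snd (analyticAt_mono _ 0)).fun_mul (an_snd (hb k))).fun_mul (h1 k)
  induction N with
  | zero =>
    intro β hβ γ b u hb hu hu0 hk
    have hβ0 : β = 0 := by
      ext i
      simpa using (Finset.sum_eq_zero_iff.1 hβ) i (Finset.mem_univ i)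
    subst hβ0
    obtain ⟨k, hkm, hbk⟩ := hk
    have huz : AnalyticAt ℝ (fun z : ℝ => u (z, 0)) 0 :=
      an_comp hu (analyticAt_id.prod analyticAt_const) rfl
    obtain ⟨d, hd, hord⟩ := order_lt (m+1) (fun k => if k < m then b k 0 else 0)
      (fun z => u (z, 0)) huz ⟨k, by omega, by simp [hkm, hbk]⟩
    refine IH d (by omega) γ _ (by simpa using hbr 0 0 b u hb hu) ?_
    rw [← hord]
    congr 1
    funext z
    rw [Finset.sum_range_succ]
    simp only [smul_zero, mono_zero, lt_irrefl, if_false, zero_mul, add_zero, one_mul]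
    congr 1
    exact Finset.sum_congr rfl fun k hk => by simp [Finset.mem_range.1 hk]
  | succ N ih =>
    intro β hβ γ b u hb hu hu0 hk
    obtain ⟨i, hi⟩ : ∃ i, β i ≠ 0 := by
      by_contra hne
      push Not at hne
      simp [hne] at hβ
    have hβne : β ≠ 0 := fun h => hi (by simp [h])
    obtain ⟨β', rfl⟩ := exists_single_add hi
    have hβ' : ∑ i, β' i = N := by
      simp [Finset.sum_add_distrib] at hβ; omega
    refine .step _ (Option ℝ) (blow i) (blow_analytic i) (blow_zero i) (cover_blow i) ?_
    intro o
    cases o with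
    | none =>
      apply Unif.base
      have hφ2 : AnalyticAt ℝ (fun p : ℝ × (Fin n → ℝ) => (blow i none p).2) 0 :=
        analyticAt_snd.fun_comp (blow_analytic i none)
      have h02 : (blow i none (0 : ℝ × (Fin n → ℝ))).2 = 0 := by rw [blow_zero]; rfl
      refine ⟨γ i + (m+1), γ, fun p => ∑ k ∈ Finset.range m, p.1^((m+1-k) * β' i) *
        mono ((m+1-k) • (Pi.single i 1 + β')) p.2 * b k (blow i none p).2 + u (blow i none p),
        ?_, ?_, .of_forall fun p => ?_⟩
      · refine AnalyticAt.fun_add (Finset.analyticAt_fun_sum _ fun k _ => ?_)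
          (an_comp hu (blow_analytic i none) (blow_zero i none))
        exact ((analyticAt_fst.fun_pow _).fun_mul (an_snd (analyticAt_mono _ 0))).fun_mul
          (an_comp (hb k) hφ2 h02)
      · simp only [blow_zero]
        rw [Finset.sum_eq_zero]
        · simpa using hu0
        · intro k hk
          have hk := Finset.mem_range.1 hk
          have : mono ((m+1-k) • (Pi.single i 1 + β')) (0 : ℝ × (Fin n → ℝ)).2 = 0 := by
            apply mono_at_zero
            rw [smul_ne_zero_iff]
            exact ⟨by omega, hβne⟩
          rw [this]; ring
      · have h1 : (blow i none p).1 = p.1 := rfl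
        have h2 : ∀ δ, mono δ (blow i none p).2 = p.1 ^ δ i * mono δ p.2 := fun δ =>
          mono_update δ i p.1 p.2
        simp only [h1, h2]
        have h3 : ∀ k ∈ Finset.range m, p.1 ^ ((m+1-k) • (Pi.single i 1 + β') : Fin n → ℕ) i *
            mono ((m+1-k) • (Pi.single i 1 + β')) p.2 * b k (blow i none p).2 * p.1 ^ k
            = p.1 ^ (m+1) * (p.1^((m+1-k) * β' i) *
        mono ((m+1-k) • (Pi.single i 1 + β')) p.2 * b k (blow i none p).2) := by
          intro k hk
          have hk := Finset.mem_range.1 hk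
          have h4 : p.1 ^ (m+1) = p.1 ^ (m+1-k) * p.1 ^ k := by rw [← pow_add]; congr 1; omega
          have h5 : p.1 ^ (((m+1-k) • (Pi.single i 1 + β') : Fin n → ℕ) i) =
              p.1 ^ (m+1-k) * p.1 ^ ((m+1-k) * β' i) := by
            rw [← pow_add]; congr 1; simp; ring
          rw [h4, h5]; ring
        rw [Finset.sum_congr rfl h3, ← Finset.mul_sum]
        ring
    | some c =>
      set g' : ℝ × (Fin n → ℝ) → ℝ := fun p => (∑ k ∈ Finset.range m,
        mono ((m+1-k) • β') p.2 * b k p.2 * (c + p.1) ^ k +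
          (c + p.1) ^ (m+1) * u (blow i (some c) p)) with hg'
      have hu' : AnalyticAt ℝ (fun p => u (blow i (some c) p)) 0 :=
        an_comp hu (blow_analytic i _) (blow_zero i _)
      have hg'a : AnalyticAt ℝ g' 0 := hbr c β' b _ hb hu'
      have heq : (fun p : ℝ × (Fin n → ℝ) => (fun p => mono γ p.2 * (∑ k ∈ Finset.range m,
          mono ((m+1-k) • (Pi.single i 1 + β')) p.2 * b k p.2 * p.1 ^ k + p.1 ^ (m+1) * u p))
          (blow i (some c) p)) = fun p => mono (γ + (m+1) • Pi.single i 1) p.2 * g' p := by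
        funext p
        have h1 : (blow i (some c) p).1 = p.2 i * (c + p.1) := rfl
        have h2 : (blow i (some c) p).2 = p.2 := rfl
        simp only [h1, h2, hg']
        have h3 : ∀ k ∈ Finset.range m, mono ((m+1-k) • (Pi.single i 1 + β')) p.2 * b k p.2 *
            (p.2 i * (c + p.1)) ^ k
            = p.2 i ^ (m+1) * (mono ((m+1-k) • β') p.2 * b k p.2 * (c + p.1) ^ k) := by
          intro k hk
          have hk := Finset.mem_range.1 hk
          have h4 : p.2 i ^ (m+1) = p.2 i ^ (m+1-k) * p.2 i ^ k := by
            rw [← pow_add]; congr 1; omega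
          rw [smul_add, mono_add, mono_smul, mono_single, h4, mul_pow]; ring
        rw [Finset.sum_congr rfl h3, ← Finset.mul_sum, mono_add, mono_smul, mono_single, mul_pow]
        ring
      rw [heq]
      by_cases hc : c = 0
      · subst hc
        have := ih β' hβ' (γ + (m+1) • Pi.single i 1) b (fun p => u (blow i (some 0) p)) hb hu'
          (by simpa [blow_zero] using hu0) hk
        simpa [hg'] using this
      by_cases hβ0 : β' = 0
      · -- order drops
        let P : Polynomial ℝ := ∑ k ∈ Finset.range m,
          Polynomial.C (b k 0) * (Polynomial.X + Polynomial.C c)^k +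
            Polynomial.C (u 0) * (Polynomial.X + Polynomial.C c)^(m+1)
        have hdeg : P.natDegree < m + 2 := by
          have : P.natDegree ≤ m + 1 := by
            refine Polynomial.natDegree_add_le_of_degree_le
              (Polynomial.natDegree_sum_le_of_forall_le _ _ fun k hk => ?_) ?_
            · have hk := Finset.mem_range.1 hk
              refine (Polynomial.natDegree_C_mul_le _ _).trans ?_
              rw [Polynomial.natDegree_pow, Polynomial.natDegree_X_add_C]; omega
            · refine (Polynomial.natDegree_C_mul_le _ _).trans ?_
              rw [Polynomial.natDegree_pow, Polynomial.natDegree_X_add_C]; omega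
          omega
        have hcoef : P.coeff m ≠ 0 := by
          have : P.coeff m = u 0 * (c * (m+1)) := by
            simp only [P, Polynomial.coeff_add, Polynomial.finsetSum_coeff,
              Polynomial.coeff_C_mul, Polynomial.coeff_X_add_C_pow]
            rw [Finset.sum_eq_zero]
            · simp
            · intro k hk
              have hk := Finset.mem_range.1 hk
              simp [Nat.choose_eq_zero_of_lt hk]
          rw [this]
          have : (m:ℝ) + 1 ≠ 0 := by positivity
          exact mul_ne_zero hu0 (mul_ne_zero hc this)
        obtain ⟨d, hd, hord⟩ := order_lt (m+1) P.coeff (fun _ => P.coeff (m+1)) analyticAt_const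
          ⟨m, by omega, hcoef⟩
        refine IH d (by omega) _ g' hg'a ?_
        rw [← hord]
        congr 1
        funext z
        have h1 : P.eval z = ∑ k ∈ Finset.range (m+1), P.coeff k * z^k + z^(m+1) * P.coeff (m+1) := by
          rw [Polynomial.eval_eq_sum_range' hdeg, Finset.sum_range_succ]; ring
        rw [← h1]
        have h2 : blow i (some c) (z, (0 : Fin n → ℝ)) = 0 := by simp [blow]
        simp only [hg', h2, hβ0, smul_zero, mono_zero, one_mul, P, Polynomial.eval_add,
          Polynomial.eval_finsetSum, Polynomial.eval_mul, Polynomial.eval_C, Polynomial.eval_pow,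
          Polynomial.eval_X]
        simp only [add_comm c z]
        ring
      · -- unit
        apply Unif.base
        refine ⟨0, γ + (m+1) • Pi.single i 1, g', hg'a, ?_, .of_forall fun p => by ring⟩
        simp only [hg', blow_zero]
        rw [Finset.sum_eq_zero]
        · simpa using ⟨hc, hu0⟩
        · intro k hk
          have hk := Finset.mem_range.1 hk
          have : mono ((m+1-k) • β') (0 : ℝ × (Fin n → ℝ)).2 = 0 := by
            apply mono_at_zero
            rw [smul_ne_zero_iff]
            exact ⟨by omega, hβ0⟩
          rw [this]; ring

end Loj

namespace Loj
open Filter Topology Set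
variable {n : ℕ}

/-- the power substitution -/
def sig (N : ℕ) (ε : Fin n → Bool) (y : Fin n → ℝ) : Fin n → ℝ := fun j => sgn (ε j) * y j ^ N

theorem sgn_ne (b : Bool) : sgn b ≠ 0 := by cases b <;> simp [sgn]
theorem abs_sgn (b : Bool) : |sgn b| = 1 := by cases b <;> simp [sgn]

theorem sig_zero (N : ℕ) (hN : N ≠ 0) (ε : Fin n → Bool) : sig N ε 0 = 0 := by
  funext j; simp [sig, hN]

theorem sig_analytic (N : ℕ) (ε : Fin n → Bool) : AnalyticAt ℝ (sig N ε) 0 :=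
  AnalyticAt.pi fun j => analyticAt_const.fun_mul ((analyticAt_coord j 0).fun_pow N)

theorem mono_sig (N : ℕ) (ε : Fin n → Bool) (γ : Fin n → ℕ) (y : Fin n → ℝ) :
    mono γ (sig N ε y) = mono γ (fun j => sgn (ε j)) * mono γ y ^ N := by
  simp only [mono, sig, mul_pow, Finset.prod_mul_distrib, ← Finset.prod_pow]
  congr 1
  exact Finset.prod_congr rfl fun j _ => by rw [← pow_mul, ← pow_mul, mul_comm]

theorem mono_sgn_ne (ε : Fin n → Bool) (γ : Fin n → ℕ) : mono γ (fun j => sgn (ε j)) ≠ 0 :=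
  Finset.prod_ne_zero_iff.2 fun j _ => pow_ne_zero _ (sgn_ne _)

theorem abs_mono_sgn (ε : Fin n → Bool) (γ : Fin n → ℕ) : |mono γ (fun j => sgn (ε j))| = 1 := by
  simp [mono, Finset.abs_prod, abs_pow, abs_sgn]

/-- exponents -/
def ex (m k : ℕ) : ℕ := 2 * (Nat.factorial (m+1) / (m+1-k))

theorem ex_mul {m k : ℕ} (hk : k < m) : (m+1-k) * ex m k = 2 * Nat.factorial (m+1) := by
  unfold ex
  have : (m+1-k) ∣ Nat.factorial (m+1) := Nat.dvd_factorial (by omega) (by omega)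
  rw [Nat.mul_left_comm, Nat.mul_div_cancel' this]

theorem ex_ne {m k : ℕ} (hk : k < m) : ex m k ≠ 0 := by
  intro h
  have := ex_mul hk
  rw [h] at this
  have := Nat.factorial_pos (m+1)
  omega

theorem ex_even (m k : ℕ) : Even (ex m k) := even_two_mul _

theorem lift_base (m : ℕ) (IH : ∀ d ≤ m, SS n d) (e : (Fin n → ℝ) → ℝ) (a : ℕ → (Fin n → ℝ) → ℝ)
    (u : ℝ × (Fin n → ℝ) → ℝ) (he : BE n e)
    (hH : BE n (fun x => ∑ k ∈ Finset.range m, a k x ^ ex m k))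
    (ha : ∀ k, AnalyticAt ℝ (a k) 0) (hu : AnalyticAt ℝ u 0)
    (hu0 : u 0 ≠ 0) :
    Unif (BX n) (fun p => e p.2 * (∑ k ∈ Finset.range m, a k p.2 * p.1 ^ k + p.1 ^ (m+1) * u p)) := by
  obtain ⟨γ, u1, hu1, hu10, he⟩ := he
  obtain ⟨δ, w, hw, hw0, hH⟩ := hH
  set N := 2 * Nat.factorial (m+1) with hN
  have hN0 : N ≠ 0 := by have := Nat.factorial_pos (m+1); omega
  refine .step _ _ _ (fun ε => ?_) (fun ε => ?_) (cover_prod (cover_pow N hN0)) (fun ε => ?_)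
  · exact analyticAt_fst.prod ((sig_analytic N ε).fun_comp (f := Prod.snd) (x := (0 : ℝ × (Fin n → ℝ))) analyticAt_snd)
  · exact Prod.ext rfl (sig_zero N hN0 ε)
  change Unif (BX n) (fun p => e (sig N ε p.2) *
    (∑ k ∈ Finset.range m, a k (sig N ε p.2) * p.1 ^ k + p.1 ^ (m+1) * u (p.1, sig N ε p.2)))
  have hσ : Tendsto (sig N ε) (𝓝 0) (𝓝 0) := by
    simpa [sig_zero N hN0 ε] using (sig_analytic N ε).continuousAt.tendsto
  have hpair : AnalyticAt ℝ (fun p : ℝ × (Fin n → ℝ) => (p.1, sig N ε p.2)) 0 :=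
    analyticAt_fst.prod ((sig_analytic N ε).fun_comp (f := Prod.snd) (x := (0 : ℝ × (Fin n → ℝ))) analyticAt_snd)
  have haσ : ∀ k, AnalyticAt ℝ (fun y => a k (sig N ε y)) 0 := fun k =>
    an_comp (ha k) (sig_analytic N ε) (sig_zero N hN0 ε)
  have hwσ : AnalyticAt ℝ (fun y => w (sig N ε y)) 0 :=
    an_comp hw (sig_analytic N ε) (sig_zero N hN0 ε)
  have hu1σ : AnalyticAt ℝ (fun y => u1 (sig N ε y)) 0 :=
    an_comp hu1 (sig_analytic N ε) (sig_zero N hN0 ε)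
  have hHσ := hσ.eventually hH
  have heσ := hσ.eventually he
  set K : ℝ := |w 0| + 1 with hK
  have hK1 : 1 ≤ K := by have := abs_nonneg (w 0); linarith
  have hwK : ∀ᶠ y in 𝓝 0, |w (sig N ε y)| < K := by
    have := hwσ.continuousAt.abs
    refine this.eventually_lt_const ?_
    simp [sig_zero N hN0 ε, hK]
  have hb : ∀ k, ∃ b : (Fin n → ℝ) → ℝ, AnalyticAt ℝ b 0 ∧ (k < m → ∀ᶠ y in 𝓝 0,
      a k (sig N ε y) = mono ((m+1-k) • δ) y * b y) := by
    intro k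
    by_cases hk : k < m
    · obtain ⟨b, hb, hab⟩ := div_mono _ ((m+1-k) • δ) rfl (fun y => a k (sig N ε y)) K (haσ k) (by
        filter_upwards [hHσ, hwK] with y h1 h2
        have h3 : |a k (sig N ε y)| ^ ex m k ≤ (K * |mono ((m+1-k) • δ) y|) ^ ex m k := by
          calc |a k (sig N ε y)| ^ ex m k = a k (sig N ε y) ^ ex m k := (ex_even m k).pow_abs _
            _ ≤ ∑ k ∈ Finset.range m, a k (sig N ε y) ^ ex m k :=
                Finset.single_le_sum (f := fun k => a k (sig N ε y) ^ ex m k)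
                  (fun j _ => (ex_even m j).pow_nonneg _) (Finset.mem_range.2 hk)
            _ = mono δ (sig N ε y) * w (sig N ε y) := h1
            _ ≤ |mono δ (sig N ε y) * w (sig N ε y)| := le_abs_self _
            _ = |w (sig N ε y)| * |mono δ y| ^ N := by
                rw [abs_mul, mono_sig, abs_mul, abs_mono_sgn, abs_pow]; ring
            _ ≤ K ^ ex m k * |mono δ y| ^ N := by
                gcongr
                exact h2.le.trans (le_self_pow₀ hK1 (ex_ne hk))
            _ = (K * |mono ((m+1-k) • δ) y|) ^ ex m k := by
                rw [mul_pow, mono_smul, abs_pow, ← pow_mul, ex_mul hk]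
        exact le_of_pow_le_pow_left₀ (ex_ne hk) (by positivity) h3)
      exact ⟨b, hb, fun _ => hab⟩
    · exact ⟨fun _ => 0, analyticAt_const, fun h => absurd h hk⟩
  choose b hb hab using hb
  have hab' : ∀ᶠ y in 𝓝 0, ∀ k ∈ Finset.range m,
      a k (sig N ε y) = mono ((m+1-k) • δ) y * b k y := by
    rw [Filter.eventually_all_finset]
    exact fun k hk => hab k (Finset.mem_range.1 hk)
  have hsum : ∀ᶠ y in 𝓝 0, ∑ k ∈ Finset.range m, b k y ^ ex m k =
      mono δ (fun j => sgn (ε j)) * w (sig N ε y) := by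
    apply mono_cancel (N • δ) (Finset.analyticAt_fun_sum _ fun k _ => (hb k).fun_pow _)
      (analyticAt_const.fun_mul hwσ)
    filter_upwards [hab', hHσ] with y h1 h2
    rw [mono_sig] at h2
    rw [mono_smul]
    have : mono δ y ^ N * ∑ k ∈ Finset.range m, b k y ^ ex m k =
        ∑ k ∈ Finset.range m, a k (sig N ε y) ^ ex m k := by
      rw [Finset.mul_sum]
      refine Finset.sum_congr rfl fun k hk => ?_
      rw [h1 k hk, mul_pow, mono_smul, ← pow_mul, ex_mul (Finset.mem_range.1 hk)]
    rw [this, h2]; ring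
  have hk : ∃ k < m, b k 0 ≠ 0 := by
    by_contra hne
    push Not at hne
    have h1 := hsum.self_of_nhds
    rw [sig_zero N hN0, Finset.sum_eq_zero] at h1
    · exact mul_ne_zero (mono_sgn_ne ε δ) hw0 h1.symm
    · intro k hk
      have hk := Finset.mem_range.1 hk
      rw [hne k hk, zero_pow (ex_ne hk)]
  have hmain := blow_unif m IH _ δ rfl (N • γ) b (fun p => u (p.1, sig N ε p.2)) hb
    (an_comp hu hpair (Prod.ext rfl (sig_zero N hN0 ε)))
    (by
      have : ((0 : ℝ × (Fin n → ℝ)).1, sig N ε (0 : ℝ × (Fin n → ℝ)).2) = 0 :=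
        Prod.ext rfl (sig_zero N hN0 ε)
      simpa only [this] using hu0) hk
  have hmain2 := Unif.unit_mul (fun _ _ h h1 h2 => BX.unit_mul h h1 h2) hmain
    (u := fun p => mono γ (fun j => sgn (ε j)) * u1 (sig N ε p.2))
    (analyticAt_const.fun_mul (an_snd hu1σ))
    (mul_ne_zero (mono_sgn_ne ε γ) (by
      have : sig N ε (0 : ℝ × (Fin n → ℝ)).2 = 0 := sig_zero N hN0 ε
      simpa only [this] using hu10))
  refine Unif.congr (fun _ _ h h1 => BX.congr h h1) hmain2 ?_
  have hsnd : Tendsto (fun p : ℝ × (Fin n → ℝ) => p.2) (𝓝 0) (𝓝 0) := continuous_snd.tendsto _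
  filter_upwards [hsnd.eventually hab', hsnd.eventually heσ] with p h1 h2
  rw [h2, mono_sig, mono_smul]
  have : ∑ k ∈ Finset.range m, a k (sig N ε p.2) * p.1 ^ k =
      ∑ k ∈ Finset.range m, mono ((m+1-k) • δ) p.2 * b k p.2 * p.1 ^ k :=
    Finset.sum_congr rfl fun k hk => by rw [h1 k hk]
  rw [this]; ring

theorem lift (m : ℕ) (IH : ∀ d ≤ m, SS n d) {h : (Fin n → ℝ) → ℝ} (hU : Unif (BE n) h) :
    ∀ (e : (Fin n → ℝ) → ℝ) (a : ℕ → (Fin n → ℝ) → ℝ)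
    (u : ℝ × (Fin n → ℝ) → ℝ), AnalyticAt ℝ e 0 → (∀ k, AnalyticAt ℝ (a k) 0) →
    AnalyticAt ℝ u 0 → u 0 ≠ 0 →
    (∀ᶠ x in 𝓝 0, h x = e x * ∑ k ∈ Finset.range m, a k x ^ ex m k) →
    Unif (BX n) (fun p => e p.2 * (∑ k ∈ Finset.range m, a k p.2 * p.1 ^ k + p.1 ^ (m+1) * u p)) := by
  induction hU with
  | base h hB =>
    intro e a u he ha hu hu0 heq
    obtain ⟨δ0, w0, hw0, hw00, hh⟩ := hB
    obtain ⟨h1, h2⟩ := BE.factor _ δ0 rfl e (fun x => ∑ k ∈ Finset.range m, a k x ^ ex m k) w0 he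
      (Finset.analyticAt_fun_sum _ fun k _ => (ha k).fun_pow _) hw0 hw00
      (by filter_upwards [heq, hh] with x h1 h2; rw [← h1, h2])
    exact lift_base m IH e a u h1 h2 ha hu hu0
  | step h ι φ hφ h0 hc hU ih =>
    intro e a u he ha hu hu0 heq
    have hpair : ∀ i, AnalyticAt ℝ (fun p : ℝ × (Fin n → ℝ) => (p.1, φ i p.2)) 0 := fun i =>
      analyticAt_fst.prod
        ((hφ i).fun_comp (f := Prod.snd) (x := (0 : ℝ × (Fin n → ℝ))) analyticAt_snd)
    have hpair0 : ∀ i, (fun p : ℝ × (Fin n → ℝ) => (p.1, φ i p.2)) 0 = 0 := fun i =>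
      Prod.ext rfl (h0 i)
    refine .step _ _ _ hpair hpair0 (cover_prod hc) (fun i => ?_)
    have hσ : Tendsto (φ i) (𝓝 0) (𝓝 0) := by
      simpa [h0 i] using (hφ i).continuousAt.tendsto
    refine ih i (fun x => e (φ i x)) (fun k x => a k (φ i x)) (fun p => u (p.1, φ i p.2))
      (an_comp he (hφ i) (h0 i)) (fun k => an_comp (ha k) (hφ i) (h0 i))
      (an_comp hu (hpair i) (hpair0 i)) ?_ (hσ.eventually heq)
    have := hpair0 i
    simp only at this
    rwa [this]

end Loj

namespace Loj
open Filter Topology Set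
variable {X : Type*} [NormedAddCommGroup X] [NormedSpace ℝ X]

theorem an_snd' {a : X → ℝ} (ha : AnalyticAt ℝ a 0) :
    AnalyticAt ℝ (fun p : ℝ × X => a p.2) 0 :=
  AnalyticAt.fun_comp (g := a) (f := Prod.snd) (x := (0 : ℝ × X)) ha analyticAt_snd

theorem taylor [CompleteSpace X] : ∀ (d : ℕ) (g : ℝ × X → ℝ), AnalyticAt ℝ g 0 →
    ∃ (a : ℕ → X → ℝ) (u : ℝ × X → ℝ), (∀ k, AnalyticAt ℝ (a k) 0) ∧ AnalyticAt ℝ u 0 ∧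
      ∀ᶠ p in 𝓝 0, g p = ∑ k ∈ Finset.range d, a k p.2 * p.1 ^ k + p.1 ^ d * u p := by
  intro d
  induction d with
  | zero => exact fun g hg => ⟨fun _ _ => 0, g, fun _ => analyticAt_const, hg, by simp⟩
  | succ d ih =>
    intro g hg
    obtain ⟨g1, hg1, h1⟩ := hadamard_division (ContinuousLinearMap.fst ℝ ℝ X) (1, 0)
      ((ContinuousLinearMap.inr ℝ ℝ X).comp (ContinuousLinearMap.snd ℝ ℝ X)) (by
        intro x; ext <;> simp) hg
    obtain ⟨a, u, ha, hu, h2⟩ := ih g1 hg1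
    refine ⟨fun k => if k = 0 then fun x => g (0, x) else a (k-1), u, fun k => ?_, hu, ?_⟩
    · by_cases hk : k = 0
      · simp only [hk, if_true]
        exact an_comp hg (analyticAt_const.prod analyticAt_id) rfl
      · simp only [hk, if_false]
        exact ha _
    · filter_upwards [h1, h2] with p h1 h2
      rw [h1, h2, Finset.sum_range_succ', mul_add, Finset.mul_sum]
      simp only [if_true, Nat.add_eq_zero_iff, one_ne_zero, and_false, if_false,
        Nat.add_sub_cancel]
      simp only [ContinuousLinearMap.coe_comp, Function.comp_apply,
        ContinuousLinearMap.coe_fst', ContinuousLinearMap.coe_snd', ContinuousLinearMap.inr_apply]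
      have : ∀ k ∈ Finset.range d, p.1 * (a k p.2 * p.1 ^ k) = a k p.2 * p.1 ^ (k+1) :=
        fun k _ => by ring
      rw [Finset.sum_congr rfl this]; ring

theorem order_eq (N : ℕ) (c : ℕ → ℝ) (v f : ℝ → ℝ) (hv : AnalyticAt ℝ v 0)
    (hf : ∀ᶠ z in 𝓝 0, f z = ∑ k ∈ Finset.range N, c k * z ^ k + z ^ N * v z)
    (hord : analyticOrderAt f 0 = N) : (∀ k < N, c k = 0) ∧ v 0 ≠ 0 := by
  rw [analyticOrderAt_congr hf] at hord
  have h1 : ∀ k < N, c k = 0 := by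
    by_contra hne
    push Not at hne
    obtain ⟨d, hd, h⟩ := order_lt N c v hv hne
    rw [hord] at h
    have : N = d := by exact_mod_cast h
    omega
  refine ⟨h1, ?_⟩
  have : (fun z : ℝ => ∑ k ∈ Finset.range N, c k * z ^ k + z ^ N * v z) = (fun z => z) ^ N * v := by
    funext z
    rw [Finset.sum_eq_zero]
    · simp
    · intro k hk; rw [h1 k (Finset.mem_range.1 hk), zero_mul]
  have hid : AnalyticAt ℝ (fun z : ℝ => z) 0 := analyticAt_id
  have hid1 : analyticOrderAt (fun z : ℝ => z) 0 = 1 := analyticOrderAt_id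
  rw [this, analyticOrderAt_mul (hid.pow N) hv, analyticOrderAt_pow hid, hid1] at hord
  intro h0
  have h2 : analyticOrderAt v 0 ≠ 0 := by rw [hv.analyticOrderAt_ne_zero]; exact h0
  cases hh : analyticOrderAt v 0 with
  | top => rw [hh] at hord; simp at hord
  | coe q =>
    rw [hh] at hord h2
    have h3 : N + q = N := by simpa [← Nat.cast_add] using hord
    have : q = 0 := by omega
    exact h2 (by simp [this])

theorem iter_coeff : ∀ (m : ℕ) (c : ℕ → ℝ) (v f : ℝ → ℝ), AnalyticAt ℝ v 0 →
    (∀ᶠ z in 𝓝 0, f z = ∑ k ∈ Finset.range (m+1), c k * z ^ k + z ^ (m+1) * v z) →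
    iteratedDeriv m f 0 = m.factorial * c m := by
  intro m
  induction m with
  | zero =>
    intro c v f _ hf
    simpa using hf.self_of_nhds
  | succ m ih =>
    intro c v f hv hf
    rw [iteratedDeriv_succ', ih (fun k => (k+1) * c (k+1)) (fun z => (m+2) * v z + z * deriv v z)
      (deriv f) ((analyticAt_const.fun_mul hv).fun_add (analyticAt_id.fun_mul hv.deriv))]
    · push_cast [Nat.factorial_succ]; ring
    · filter_upwards [hf.eventually_nhds, hv.eventually_analyticAt] with z h1 h2
      rw [Filter.EventuallyEq.deriv_eq h1]
      have h3 : HasDerivAt (fun z : ℝ => ∑ k ∈ Finset.range (m+1+1), c k * z ^ k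
          + z ^ (m+1+1) * v z) (∑ k ∈ Finset.range (m+1+1), c k * (k * z ^ (k-1))
          + ((((m+1+1 : ℕ) : ℝ) * z ^ (m+1+1-1)) * v z + z ^ (m+1+1) * deriv v z)) z := by
        refine HasDerivAt.add (HasDerivAt.fun_sum fun k _ => ?_) ?_
        · exact (hasDerivAt_pow k z).const_mul _
        · exact (hasDerivAt_pow _ z).mul h2.differentiableAt.hasDerivAt
      rw [h3.deriv, Finset.sum_range_succ']
      simp only [Nat.add_sub_cancel]
      push_cast
      have : ∀ k ∈ Finset.range (m+1), c (k+1) * (((k:ℝ)+1) * z ^ k) = ((k:ℝ)+1) * c (k+1) * z ^ k :=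
        fun k _ => by ring
      rw [Finset.sum_congr rfl this]
      ring

theorem prep [CompleteSpace X] (m : ℕ) (g : ℝ × X → ℝ) (hg : AnalyticAt ℝ g 0)
    (hord : analyticOrderAt (fun z : ℝ => g (z, 0)) 0 = (m+1 : ℕ)) :
    ∃ (ψ : X → ℝ) (a : ℕ → X → ℝ) (u : ℝ × X → ℝ), AnalyticAt ℝ ψ 0 ∧ ψ 0 = 0 ∧
      (∀ k, AnalyticAt ℝ (a k) 0) ∧ AnalyticAt ℝ u 0 ∧ u 0 ≠ 0 ∧
      ∀ᶠ p in 𝓝 0, g (p.1 + ψ p.2, p.2) =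
        ∑ k ∈ Finset.range m, a k p.2 * p.1 ^ k + p.1 ^ (m+1) * u p := by
  have hshift : AnalyticAt ℝ (fun q : ℝ × (ℝ × X) => (q.1 + q.2.1, q.2.2)) 0 := by
    have h2 : AnalyticAt ℝ (fun q : ℝ × (ℝ × X) => q.2) 0 := analyticAt_snd
    exact (analyticAt_fst.fun_add (analyticAt_fst.fun_comp h2)).prod (analyticAt_snd.fun_comp h2)
  obtain ⟨A, U, hA, hU, hAU⟩ := taylor (m+1) (fun q : ℝ × (ℝ × X) => g (q.1 + q.2.1, q.2.2))
    (an_comp hg hshift (by simp))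
  set f : ℝ → ℝ := fun z => g (z, 0) with hf
  have hfa : AnalyticAt ℝ f 0 := an_comp hg (analyticAt_id.prod analyticAt_const) rfl
  -- the equation on the slice
  have hUz : AnalyticAt ℝ (fun z : ℝ => U (z, 0)) 0 :=
    an_comp hU (analyticAt_id.prod analyticAt_const) rfl
  obtain ⟨hA0, hU0⟩ := order_eq (m+1) (fun k => A k 0) (fun z => U (z, 0)) f hUz (by
    have ht : Tendsto (fun z : ℝ => (z, (0 : ℝ × X))) (𝓝 0) (𝓝 0) := by
      have : Continuous (fun z : ℝ => (z, (0 : ℝ × X))) := by fun_prop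
      exact this.tendsto 0
    filter_upwards [ht.eventually hAU] with z hz
    simpa [hf] using hz) hord
  have hslice : ∀ᶠ t in 𝓝 (0:ℝ), A m (t, 0) = (m.factorial : ℝ)⁻¹ * iteratedDeriv m f t := by
    have ht : Tendsto (fun t : ℝ => ((0:ℝ), (t, (0:X)))) (𝓝 0) (𝓝 0) := by
      have : Continuous (fun t : ℝ => ((0:ℝ), (t, (0:X)))) := by fun_prop
      exact this.tendsto 0
    filter_upwards [ht.eventually hAU.eventually_nhds, ht.eventually hU.eventually_analyticAt]
      with t h1 h2
    have hz : Tendsto (fun z : ℝ => (z, (t, (0:X)))) (𝓝 0) (𝓝 (0, (t, 0))) := by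
      have : Continuous (fun z : ℝ => (z, (t, (0:X)))) := by fun_prop
      exact this.tendsto 0
    have h3 : AnalyticAt ℝ (fun z : ℝ => U (z, (t, 0))) 0 :=
      AnalyticAt.fun_comp (g := U) (f := fun z : ℝ => (z, (t, (0:X)))) h2
        (analyticAt_id.prod analyticAt_const)
    have h4 := iter_coeff m (fun k => A k (t, 0)) (fun z => U (z, (t, 0))) (fun z => f (z + t)) h3
      (hz.eventually h1)
    rw [iteratedDeriv_comp_add_const] at h4
    simp only [zero_add] at h4
    rw [h4]
    have : (m.factorial : ℝ) ≠ 0 := by positivity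
    field_simp
  have hderiv : deriv (fun t : ℝ => A m (t, 0)) 0 ≠ 0 := by
    rw [Filter.EventuallyEq.deriv_eq hslice, deriv_const_mul_field, ← iteratedDeriv_succ]
    have := ((analyticOrderAt_eq_nat_iff_iteratedDeriv_eq_zero hfa).1 hord).2
    have : (m.factorial : ℝ) ≠ 0 := by positivity
    positivity
  -- implicit function
  set G : X × ℝ → ℝ := fun q => A m (q.2, q.1) with hG
  have hGa : AnalyticAt ℝ G 0 := an_comp (hA m) (analyticAt_snd.prod analyticAt_fst) rfl
  have hGd : fderiv ℝ G 0 (0, 1) ≠ 0 := by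
    have h1 : HasFDerivAt G (fderiv ℝ G 0) ((fun t : ℝ => ((0:X), t)) 0) :=
      hGa.differentiableAt.hasFDerivAt
    have h2 : HasDerivAt (fun t : ℝ => ((0:X), t)) (0, 1) 0 :=
      (hasDerivAt_const _ _).prodMk (hasDerivAt_id _)
    have h3 := h1.comp_hasDerivAt (0:ℝ) h2
    rw [← h3.deriv]
    exact hderiv
  have hinv : (fderiv ℝ G 0 ∘L .inr ℝ X ℝ).IsInvertible := by
    set c := fderiv ℝ G 0 (0, 1) with hc
    have hL : ∀ t : ℝ, fderiv ℝ G 0 (0, t) = t * c := by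
      intro t
      have : ((0:X), t) = t • ((0:X), (1:ℝ)) := by simp
      rw [this, map_smul, smul_eq_mul]
    refine ContinuousLinearMap.IsInvertible.of_inverse (g := c⁻¹ • ContinuousLinearMap.id ℝ ℝ) ?_ ?_
    · ext
      simp [hL, hGd]
    · ext
      simp [hL, hGd]
  have hGc : ContDiffAt ℝ ⊤ G 0 := hGa.contDiffAt
  set ψ := hGc.implicitFunction (by simp) hinv with hψ
  have hψa : AnalyticAt ℝ ψ 0 := by
    have := hGc.contDiffAt_implicitFunction (by simp) hinv
    exact analyticWithinAt_univ.1 (contDiffWithinAt_omega_iff_analyticWithinAt.1 this)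
  have hψ0 : ψ 0 = 0 := hGc.implicitFunction_apply_self (by simp) hinv
  have hψG : ∀ᶠ x in 𝓝 (0:X), A m (ψ x, x) = 0 := by
    have := hGc.eventually_apply_implicitFunction (by simp) hinv
    refine this.mono fun x hx => hx.trans ?_
    exact hA0 m (by omega)
  have hpair : AnalyticAt ℝ (fun x => (ψ x, x)) 0 := hψa.prod analyticAt_id
  have hpair0 : (ψ 0, (0:X)) = 0 := by rw [hψ0]; rfl
  have hpair2 : AnalyticAt ℝ (fun p : ℝ × X => (p.1, (ψ p.2, p.2))) 0 :=
    analyticAt_fst.prod ((an_snd' hψa).prod analyticAt_snd)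
  have hpair20 : (fun p : ℝ × X => (p.1, (ψ p.2, p.2))) 0 = 0 := by
    simp [hψ0]
  refine ⟨ψ, fun k x => A k (ψ x, x), fun p => U (p.1, (ψ p.2, p.2)), hψa, hψ0,
    fun k => an_comp (hA k) hpair hpair0, an_comp hU hpair2 hpair20, ?_, ?_⟩
  · simp only at hpair20
    change U (((0 : ℝ × X).1, (ψ (0 : ℝ × X).2, (0 : ℝ × X).2))) ≠ 0
    rw [hpair20]; exact hU0
  · have ht : Tendsto (fun p : ℝ × X => (p.1, (ψ p.2, p.2))) (𝓝 0) (𝓝 0) := by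
      have := hpair2.continuousAt.tendsto
      simp only at hpair20
      rwa [hpair20] at this
    have hs : Tendsto (fun p : ℝ × X => p.2) (𝓝 0) (𝓝 0) := continuous_snd.tendsto _
    filter_upwards [ht.eventually hAU, hs.eventually hψG] with p h1 h2
    rw [h1, Finset.sum_range_succ]
    simp only [h2]
    ring

end Loj

namespace Loj
open Filter Topology Set
variable {n : ℕ}

/-- Uniformization of all nonzero analytic germs in `n` variables. -/
def TT (n : ℕ) : Prop := ∀ f : (Fin n → ℝ) → ℝ, AnalyticAt ℝ f 0 →
  (¬ ∀ᶠ x in 𝓝 0, f x = 0) → Unif (BE n) f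

theorem SS_all (hT : TT n) : ∀ d, SS n d := by
  intro d
  induction d using Nat.strong_induction_on with
  | _ d ih =>
  cases d with
  | zero =>
    intro γ g hg hord
    apply Unif.base
    refine ⟨0, γ, g, hg, ?_, .of_forall fun p => by ring⟩
    have hga : AnalyticAt ℝ (fun z : ℝ => g (z, 0)) 0 :=
      an_comp hg (analyticAt_id.prod analyticAt_const) rfl
    exact hga.analyticOrderAt_eq_zero.1 (by simpa using hord)
  | succ m =>
    intro γ g hg hord
    have IH : ∀ d ≤ m, SS n d := fun d hd => ih d (by omega)
    obtain ⟨ψ, a, u, hψ, hψ0, ha, hu, hu0, heq⟩ := prep m g hg hord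
    have hsh : AnalyticAt ℝ (fun p : ℝ × (Fin n → ℝ) => (p.1 + ψ p.2, p.2)) 0 :=
      (analyticAt_fst.fun_add (an_snd hψ)).prod analyticAt_snd
    have hsh' : AnalyticAt ℝ (fun p : ℝ × (Fin n → ℝ) => (p.1 - ψ p.2, p.2)) 0 :=
      (analyticAt_fst.fun_sub (an_snd hψ)).prod analyticAt_snd
    refine .step _ Unit (fun _ p => (p.1 + ψ p.2, p.2)) (fun _ => hsh)
      (fun _ => by simp [hψ0])
      (cover_single hsh'.continuousAt (by simp [hψ0]) (.of_forall fun p => by simp)) fun _ => ?_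
    suffices hs : Unif (BX n) (fun p => mono γ p.2 *
        (∑ k ∈ Finset.range m, a k p.2 * p.1 ^ k + p.1 ^ (m+1) * u p)) by
      refine Unif.congr (fun _ _ h h1 => BX.congr h h1) hs ?_
      filter_upwards [heq] with p hp
      simp only [hp]
    have hHa : AnalyticAt ℝ (fun x => ∑ k ∈ Finset.range m, a k x ^ ex m k) 0 :=
      Finset.analyticAt_fun_sum _ fun k _ => (ha k).fun_pow _
    by_cases hH : ∀ᶠ x in 𝓝 0, ∑ k ∈ Finset.range m, a k x ^ ex m k = 0
    · apply Unif.base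
      refine ⟨m+1, γ, u, hu, hu0, ?_⟩
      have hs : Tendsto (fun p : ℝ × (Fin n → ℝ) => p.2) (𝓝 0) (𝓝 0) := continuous_snd.tendsto _
      filter_upwards [hs.eventually hH] with p hp
      rw [Finset.sum_eq_zero_iff_of_nonneg (fun k _ => (ex_even m k).pow_nonneg _)] at hp
      rw [Finset.sum_eq_zero]
      · ring
      · intro k hk
        rw [eq_zero_of_pow_eq_zero (hp k hk), zero_mul]
    · have h1 : Unif (BE n) (fun x => mono γ x * ∑ k ∈ Finset.range m, a k x ^ ex m k) := by
        refine hT _ ((analyticAt_mono γ 0).fun_mul hHa) fun h => ?_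
        rcases mul_eq_zero_germ (analyticAt_mono γ 0) hHa h with h | h
        · exact mono_not_zero γ h
        · exact hH h
      exact lift m IH h1 (mono γ) a u (analyticAt_mono γ 0) ha hu hu0 (.of_forall fun _ => rfl)

theorem cover_conj {X Y : Type*} [NormedAddCommGroup X] [NormedSpace ℝ X] [NormedAddCommGroup Y]
    [NormedSpace ℝ Y] (E : X ≃L[ℝ] Y) {ι : Type} {φ : ι → X → X} (h : Cover φ) :
    Cover (fun i y => E (φ i (E.symm y))) := by
  intro p h0 hmono hunion hW
  have hE : Tendsto E (𝓝 0) (𝓝 0) := by simpa using E.continuous.tendsto 0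
  have hE' : Tendsto E.symm (𝓝 0) (𝓝 0) := by simpa using E.symm.continuous.tendsto 0
  obtain ⟨V, hV, hp⟩ := h (fun S => p (E '' S)) (by simpa using h0)
    (fun s t hst ht => hmono _ _ (image_mono hst) ht)
    (fun s t hs ht => by rw [image_union]; exact hunion _ _ hs ht)
    (fun i => by
      obtain ⟨W, hW, hp⟩ := hW i
      refine ⟨E ⁻¹' W, hE hW, hmono _ _ ?_ hp⟩
      rintro _ ⟨_, ⟨x, hx, rfl⟩, rfl⟩
      exact ⟨E x, hx, by simp⟩)
  refine ⟨E.symm ⁻¹' V, hE' hV, hmono _ _ ?_ hp⟩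
  intro y hy
  exact ⟨E.symm y, hy, by simp⟩

/-- the coordinate splitting -/
noncomputable def EE (n : ℕ) : (ℝ × (Fin n → ℝ)) ≃L[ℝ] (Fin (n+1) → ℝ) :=
  Fin.consEquivL ℝ (fun _ : Fin (n+1) => ℝ)

theorem EE_symm (x : Fin (n+1) → ℝ) : (EE n).symm x = (x 0, fun i => x i.succ) := rfl

theorem transfer {f : ℝ × (Fin n → ℝ) → ℝ} (h : Unif (BX n) f) :
    Unif (BE (n+1)) (fun x => f ((EE n).symm x)) := by
  have hE' : Tendsto (EE n).symm (𝓝 0) (𝓝 0) := by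
    simpa using (EE n).symm.continuous.tendsto 0
  have hEa : ∀ x, AnalyticAt ℝ (EE n) x := fun x => (EE n).toContinuousLinearMap.analyticAt x
  have hEa' : ∀ x, AnalyticAt ℝ (EE n).symm x :=
    fun x => (EE n).symm.toContinuousLinearMap.analyticAt x
  have hE0 : (EE n).symm 0 = 0 := map_zero _
  induction h with
  | base f h =>
    obtain ⟨m, γ, u, hu, hu0, h⟩ := h
    apply Unif.base
    refine ⟨Fin.cons m γ, fun x => u ((EE n).symm x), an_comp hu (hEa' 0) hE0, ?_, ?_⟩
    · simpa only [hE0] using hu0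
    · filter_upwards [hE'.eventually h] with x hx
      rw [hx]
      simp [EE_symm, mono, Fin.prod_univ_succ]
  | step f ι φ hφ h0 hc h ih =>
    refine .step _ ι _ (fun i => ?_) (fun i => ?_) (cover_conj (EE n) hc) (fun i => ?_)
    · refine AnalyticAt.fun_comp (g := EE n) (hEa _) ?_
      refine AnalyticAt.fun_comp (g := φ i) ?_ (hEa' 0)
      rw [hE0]; exact hφ i
    · simp [h0 i]
    · simpa using ih i

theorem TT_all : ∀ n, TT n := by
  intro n
  induction n with
  | zero =>
    intro f hf hne
    apply Unif.base
    refine ⟨0, f, hf, fun h0 => hne (.of_forall fun x => ?_), .of_forall fun x => by simp [mono]⟩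
    rw [Subsingleton.elim x 0, h0]
  | succ n ih =>
    intro f hf hne
    by_cases hf0 : f 0 = 0
    swap
    · exact .base _ ⟨0, f, hf, hf0, .of_forall fun x => by simp [mono]⟩
    obtain ⟨r, hr, hball⟩ := Metric.eventually_nhds_iff_ball.1 hf.eventually_analyticAt
    obtain ⟨v, hv, hfv⟩ : ∃ v ∈ Metric.ball (0 : Fin (n+1) → ℝ) r, f v ≠ 0 := by
      by_contra hcon
      push Not at hcon
      exact hne (Filter.eventually_of_mem (Metric.ball_mem_nhds _ hr) hcon)
    have hv0 : v ≠ 0 := by rintro rfl; exact hfv hf0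
    have hsm : ∀ z : ℝ, AnalyticAt ℝ (fun z : ℝ => z • v) z := fun z =>
      ((ContinuousLinearMap.id ℝ ℝ).smulRight v).analyticAt z
    have hline : AnalyticOnNhd ℝ (fun z : ℝ => f (z • v)) (Icc 0 1) := by
      intro z hz
      refine AnalyticAt.fun_comp (g := f) (f := fun z : ℝ => z • v) (hball _ ?_) (hsm z)
      rw [mem_ball_zero_iff] at hv ⊢
      rw [norm_smul, Real.norm_of_nonneg hz.1]
      exact (mul_le_of_le_one_left (norm_nonneg _) hz.2).trans_lt hv
    have hord : analyticOrderAt (fun z : ℝ => f (z • v)) 0 ≠ ⊤ := by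
      intro h
      rw [analyticOrderAt_eq_top] at h
      have := hline.eqOn_zero_of_preconnected_of_eventuallyEq_zero isPreconnected_Icc
        (by simp : (0:ℝ) ∈ Icc (0:ℝ) 1) h (by simp : (1:ℝ) ∈ Icc (0:ℝ) 1)
      simp at this
      exact hfv this
    obtain ⟨d, hd⟩ := ENat.ne_top_iff_exists.1 hord
    have he0 : EE n (1, 0) ≠ 0 := by
      rw [Ne, map_eq_zero_iff _ (EE n).injective]; simp
    obtain ⟨A, hA⟩ := SeparatingDual.exists_continuousLinearEquiv_apply_eq (R := ℝ) he0 hv0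
    have hAa : AnalyticAt ℝ A 0 := A.toContinuousLinearMap.analyticAt 0
    have hEa : AnalyticAt ℝ (EE n) 0 := (EE n).toContinuousLinearMap.analyticAt 0
    have hAEa : AnalyticAt ℝ (fun p => A (EE n p)) 0 :=
      AnalyticAt.fun_comp (g := A) (by rw [map_zero]; exact hAa) hEa
    have h1 := SS_all ih d 0 (fun p => f (A (EE n p))) (an_comp hf hAEa (by simp)) (by
      rw [hd]
      congr 1
      funext z
      have : (z, (0 : Fin n → ℝ)) = z • ((1:ℝ), (0 : Fin n → ℝ)) := by simp
      rw [this, map_smul, map_smul, hA])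
    have h2 := transfer h1
    simp only [mono_zero, one_mul, ContinuousLinearEquiv.apply_symm_apply] at h2
    refine .step _ Unit (fun _ => A) (fun _ => hAa) (fun _ => map_zero A)
      (cover_single (ψ := A.symm) A.symm.continuous.continuousAt (map_zero _)
        (.of_forall fun x => by simp)) fun _ => h2

theorem main {n : ℕ} (F : EuclideanSpace ℝ (Fin n) → ℝ) (U : Set (EuclideanSpace ℝ (Fin n)))
    (hU : IsOpen U) (h0 : (0 : EuclideanSpace ℝ (Fin n)) ∈ U)
    (hF : AnalyticOnNhd ℝ F U) :
    ∃ α ∈ Set.Ioc (0 : ℝ) (1 / 2), ∃ C > (0 : ℝ), ∃ V ⊆ U,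
      IsOpen V ∧ (0 : EuclideanSpace ℝ (Fin n)) ∈ V ∧
        ∀ x ∈ V, |F x - F 0| ^ (1 - α) ≤ C * ‖gradient F x‖ := by
  set L := (EuclideanSpace.equiv (Fin n) ℝ).symm with hL
  have hLa : ∀ x, AnalyticAt ℝ L x := fun x => L.toContinuousLinearMap.analyticAt x
  have hF0 : AnalyticAt ℝ (fun x => F x - F 0) 0 := (hF 0 h0).fun_sub analyticAt_const
  have hfa : AnalyticAt ℝ (fun y => F (L y) - F 0) 0 := an_comp hF0 (hLa 0) (map_zero L)
  have hT' : Tendsto L.symm (𝓝 0) (𝓝 0) := by simpa using L.symm.continuous.tendsto 0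
  obtain ⟨W, hW, α, hα, C, hC, hWI⟩ : ∃ V ∈ 𝓝 (0 : Fin n → ℝ), Ineq (fun y => F (L y) - F 0) V := by
    by_cases hz : ∀ᶠ y in 𝓝 0, F (L y) - F 0 = 0
    · refine ⟨_, hz, 1/2, by norm_num, 1, one_pos, fun x hx => ?_⟩
      have hx : F (L x) - F 0 = 0 := hx
      simp only [hx, abs_zero]
      rw [Real.zero_rpow (by norm_num)]
      positivity
    · exact (TT_all n _ hfa hz).ineq (fun f h h0 => h.ineq h0) hfa (by simp)
  obtain ⟨V, hV, hVo, hV0⟩ := mem_nhds_iff.1 (hT' hW)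
  set K : ℝ := ‖(L : (Fin n → ℝ) →L[ℝ] EuclideanSpace ℝ (Fin n))‖ + 1 with hK
  have hKp : 0 < K := by positivity
  refine ⟨α, hα, C * K, by positivity, V ∩ U, inter_subset_right, hVo.inter hU, ⟨hV0, h0⟩, ?_⟩
  rintro x ⟨hxV, hxU⟩
  have h1 := hWI (L.symm x) (hV hxV)
  simp only [ContinuousLinearEquiv.apply_symm_apply] at h1
  refine h1.trans ?_
  rw [mul_assoc]
  gcongr
  have h2 : HasFDerivAt (fun y => F (L y) - F 0)
      ((fderiv ℝ F x).comp (L : (Fin n → ℝ) →L[ℝ] EuclideanSpace ℝ (Fin n))) (L.symm x) := by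
    have h3 : HasFDerivAt F (fderiv ℝ F x) (L (L.symm x)) := by
      rw [L.apply_symm_apply]
      exact (hF x hxU).differentiableAt.hasFDerivAt
    exact (h3.comp _ L.hasFDerivAt).sub_const _
  rw [h2.fderiv]
  have h4 : ‖gradient F x‖ = ‖fderiv ℝ F x‖ := by
    unfold gradient
    exact LinearIsometryEquiv.norm_map _ _
  rw [h4, mul_comm]
  refine (ContinuousLinearMap.opNorm_comp_le _ _).trans ?_
  gcongr
  rw [hK]; linarith

end Loj

/-- The finite-dimensional Łojasiewicz gradient inequality: if `F` is analytic on an open set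
`U ∋ 0` in `ℝⁿ` with `∇F(0) = 0`, then there exist `α ∈ (0, 1/2]`, `C > 0` and a
neighbourhood `V ⊆ U` of `0` such that `|F(x) - F(0)|^{1-α} ≤ C ‖∇F(x)‖` on `V`. -/
theorem lojasiewicz_gradient_inequality
    {n : ℕ} (F : EuclideanSpace ℝ (Fin n) → ℝ) (U : Set (EuclideanSpace ℝ (Fin n)))
    (hU : IsOpen U) (h0 : (0 : EuclideanSpace ℝ (Fin n)) ∈ U)
    (hF : AnalyticOnNhd ℝ F U)
    (hgrad : gradient F 0 = 0) :
    ∃ α ∈ Set.Ioc (0 : ℝ) (1 / 2), ∃ C > (0 : ℝ), ∃ V ⊆ U,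
      IsOpen V ∧ (0 : EuclideanSpace ℝ (Fin n)) ∈ V ∧
        ∀ x ∈ V, |F x - F 0| ^ (1 - α) ≤ C * ‖gradient F x‖ := by
  exact Loj.main F U hU h0 hF
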